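/- arXiv:2204.04255 — 2 statements merged into one kernel-verified Lean document; each statement's English description precedes it below -/
import Mathlib

section
/- Let R = [r] × [s] with labeling x, and let I = [i₁,i₂] × [j₁,j₂] be an interval of R such that (i₁ = 1 or j₂ = s) and (j₁ = 1 or i₂ = r). Then for every 0 ≤ k ≤ j₂ − j₁ + 1, w_I^{(k)}(x) = W_{i₁+j₁+k−1, i₂+j₁}^{(j₂−j₁−k+1)}(x) / W_{i₁+j₁−1, i₂+j₁}^{(j₂−j₁+1)}(x). -/
namespace Paper

/-- Membership in the rectangle poset `R = [1,r] × [1,s]` (coordinates in `ℤ`). -/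
def inR (r s : ℕ) (p : ℤ × ℤ) : Prop :=
  1 ≤ p.1 ∧ p.1 ≤ (r : ℤ) ∧ 1 ≤ p.2 ∧ p.2 ≤ (s : ℤ)

instance (r s : ℕ) : DecidablePred (inR r s) := fun _ => by unfold inR; infer_instance

/-- The cover relation in the product of two chains. -/
def CoverStep (p q : ℤ × ℤ) : Prop :=
  (q.1 = p.1 + 1 ∧ q.2 = p.2) ∨ (q.1 = p.1 ∧ q.2 = p.2 + 1)

/-- Upper covers of `p` inside the rectangle. -/
def upSet (r s : ℕ) (p : ℤ × ℤ) : Finset (ℤ × ℤ) :=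
  ({(p.1 + 1, p.2), (p.1, p.2 + 1)} : Finset (ℤ × ℤ)).filter (inR r s)

/-- Lower covers of `p` inside the rectangle. -/
def downSet (r s : ℕ) (p : ℤ × ℤ) : Finset (ℤ × ℤ) :=
  ({(p.1 - 1, p.2), (p.1, p.2 - 1)} : Finset (ℤ × ℤ)).filter (inR r s)

/-- Sum of the labels of the lower covers of `p` (empty sum = 1). -/
noncomputable def dsum (r s : ℕ) (x : ℤ × ℤ → ℝ) (p : ℤ × ℤ) : ℝ :=
  if (downSet r s p).Nonempty then ∑ q ∈ downSet r s p, x q else 1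

/-- Parallel sum of the labels of the upper covers of `p` (empty parallel sum = 1). -/
noncomputable def usum (r s : ℕ) (x : ℤ × ℤ → ℝ) (p : ℤ × ℤ) : ℝ :=
  if (upSet r s p).Nonempty then (∑ q ∈ upSet r s p, (x q)⁻¹)⁻¹ else 1

/-- The birational toggle at `p`. -/
noncomputable def toggle (r s : ℕ) (p : ℤ × ℤ) (x : ℤ × ℤ → ℝ) : ℤ × ℤ → ℝ :=
  fun q => if q = p then usum r s x p * dsum r s x p / x p else x q

/-- The elements of `[1,a] × [1,b]` listed from top to bottom
(descending lexicographic order, the reverse of a linear extension). -/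
def rectList (a b : ℕ) : List (ℤ × ℤ) :=
  (List.range a).reverse.flatMap fun i =>
    (List.range b).reverse.map fun j => ((i : ℤ) + 1, (j : ℤ) + 1)

/-- Birational rowmotion on the rectangle: toggles from top to bottom. -/
noncomputable def rho (r s : ℕ) (x : ℤ × ℤ → ℝ) : ℤ × ℤ → ℝ :=
  (rectList r s).foldl (fun y p => toggle r s p y) x

/-- Inverse birational rowmotion: toggles from bottom to top. -/
noncomputable def rhoInv (r s : ℕ) (x : ℤ × ℤ → ℝ) : ℤ × ℤ → ℝ :=
  (rectList r s).reverse.foldl (fun y p => toggle r s p y) x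

/-- Integer powers of birational rowmotion. -/
noncomputable def rhoPow (r s : ℕ) (k : ℤ) (x : ℤ × ℤ → ℝ) : ℤ × ℤ → ℝ :=
  if 0 ≤ k then (rho r s)^[k.toNat] x else (rhoInv r s)^[(-k).toNat] x

/-- Saturated chains from `a` to `b`, as lists of successive cover steps. -/
def ChainList (a b : ℤ × ℤ) : Type :=
  {l : List (ℤ × ℤ) // l.Chain' CoverStep ∧ l.head? = some a ∧ l.getLast? = some b}

/-- The inverse birational transfer map on the rectangle: `φ⁻¹(x)_p` is the total weight
of all saturated chains from the minimal element `(1,1)` to `p`. -/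
noncomputable def phiInv (x : ℤ × ℤ → ℝ) : ℤ × ℤ → ℝ :=
  fun p => ∑ᶠ c : ChainList (1, 1) p, (c.1.map x).prod

/-- The birational transfer map `φ(x)_p = x_p / ∑_{q ⋖ p} x_q`. -/
noncomputable def phi (r s : ℕ) (x : ℤ × ℤ → ℝ) : ℤ × ℤ → ℝ :=
  fun p => x p / dsum r s x p

/-- A collection of `k` pairwise vertex-disjoint lattice paths in the interval
`[i₁,i₂] × [j₁,j₂]`, from `(i₁,j₁),…,(i₁,j₁+k-1)` to `(i₂,j₂-k+1),…,(i₂,j₂)`. -/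
structure RSys (i₁ i₂ j₁ j₂ : ℤ) (k : ℕ) where
  path : Fin k → List (ℤ × ℤ)
  chain : ∀ t, (path t).Chain' CoverStep
  mem : ∀ t, ∀ v ∈ path t, i₁ ≤ v.1 ∧ v.1 ≤ i₂ ∧ j₁ ≤ v.2 ∧ v.2 ≤ j₂
  first : ∀ t : Fin k, (path t).head? = some (i₁, j₁ + ((t : ℕ) : ℤ))
  final : ∀ t : Fin k, (path t).getLast? = some (i₂, j₂ - k + 1 + ((t : ℕ) : ℤ))
  disjoint : ∀ t t' : Fin k, t ≠ t' → ∀ v ∈ path t, v ∉ path t'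

/-- The weight of a collection of paths: the product of labels of all its elements. -/
noncomputable def RSysWeight (x : ℤ × ℤ → ℝ) {i₁ i₂ j₁ j₂ : ℤ} {k : ℕ}
    (L : RSys i₁ i₂ j₁ j₂ k) : ℝ :=
  ∏ t : Fin k, ((L.path t).map x).prod

/-- `w_I^{(k)}(x)`: total weight of all collections of `k` nonintersecting paths in the
interval `I = [i₁,i₂] × [j₁,j₂]` (with `w_I^{(0)} = 1`). -/
noncomputable def w (i₁ i₂ j₁ j₂ : ℤ) (k : ℤ) (x : ℤ × ℤ → ℝ) : ℝ :=
  if k ≤ 0 then 1 else ∑ᶠ L : RSys i₁ i₂ j₁ j₂ k.toNat, RSysWeight x L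

/-- `w_I(x)`: the product of all labels in the interval `I = [i₁,i₂] × [j₁,j₂]`. -/
noncomputable def wProd (i₁ i₂ j₁ j₂ : ℤ) (x : ℤ × ℤ → ℝ) : ℝ :=
  ∏ p ∈ Finset.Icc i₁ i₂ ×ˢ Finset.Icc j₁ j₂, x p

/-- The directed edges of the graph `𝒢_R` on vertex set `[1,r+1] × [1,s]`:
`(i,j) → (i+1,j)` for `(i,j) ∈ R`, and `(i,j) → (i+1,j-1)` when valid. -/
def GEdge (r s : ℕ) (p q : ℤ × ℤ) : Prop :=
  1 ≤ p.1 ∧ p.1 ≤ (r : ℤ) ∧ 1 ≤ p.2 ∧ p.2 ≤ (s : ℤ) ∧ q.1 = p.1 + 1 ∧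
    (q.2 = p.2 ∨ (q.2 = p.2 - 1 ∧ 2 ≤ p.2))

/-- The weight of an edge of `𝒢_R`: `x_p⁻¹` for vertical edges, `1` for diagonal ones. -/
noncomputable def edgeWt (x : ℤ × ℤ → ℝ) (p q : ℤ × ℤ) : ℝ :=
  if q.2 = p.2 then (x p)⁻¹ else 1

/-- The weight of a directed path in `𝒢_R`, given as its list of vertices. -/
noncomputable def listWt (x : ℤ × ℤ → ℝ) (l : List (ℤ × ℤ)) : ℝ :=
  ((l.zip l.tail).map fun e => edgeWt x e.1 e.2).prod

/-- The boundary vertex `P_t` of `𝒢_R`: `P_j = (1,j)` for `1 ≤ j ≤ s`, `P_{s+i} = (i+1,s)`. -/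
def Pvert (s : ℕ) (t : ℤ) : ℤ × ℤ := if t ≤ (s : ℤ) then (1, t) else (t - s + 1, (s : ℤ))

/-- The boundary vertex `Q_t` of `𝒢_R`: `Q_i = (i,1)` for `1 ≤ i ≤ r`, `Q_{r+j} = (r+1,j)`. -/
def Qvert (r : ℕ) (t : ℤ) : ℤ × ℤ := if t ≤ (r : ℤ) then (t, 1) else ((r : ℤ) + 1, t - r)

/-- A collection of `k` pairwise vertex-disjoint directed paths in `𝒢_R` from
`{P_i, …, P_{i+k-1}}` to `{Q_j, …, Q_{j+k-1}}`. -/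
structure GSys (r s : ℕ) (i j : ℤ) (k : ℕ) where
  perm : Equiv.Perm (Fin k)
  path : Fin k → List (ℤ × ℤ)
  chain : ∀ t, (path t).Chain' (GEdge r s)
  first : ∀ t : Fin k, (path t).head? = some (Pvert s (i + ((t : ℕ) : ℤ)))
  final : ∀ t : Fin k, (path t).getLast? = some (Qvert r (j + (((perm t) : ℕ) : ℤ)))
  disjoint : ∀ t t' : Fin k, t ≠ t' → ∀ v ∈ path t, v ∉ path t'

/-- The weight of a collection of paths in `𝒢_R`: the product of the weights of all
edges used. -/
noncomputable def GSysWeight (x : ℤ × ℤ → ℝ) {r s : ℕ} {i j : ℤ} {k : ℕ}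
    (L : GSys r s i j k) : ℝ :=
  ∏ t : Fin k, listWt x (L.path t)

/-- `W_{ij}^{(k)}(x)`: total weight of all collections of `k` nonintersecting paths in
`𝒢_R` from `{P_i,…,P_{i+k-1}}` to `{Q_j,…,Q_{j+k-1}}`; `W_{ij}^{(0)} = 1`, and `0` when an
out-of-range index occurs. -/
noncomputable def W (r s : ℕ) (x : ℤ × ℤ → ℝ) (i j k : ℤ) : ℝ :=
  if k < 0 then 0
  else if k = 0 then 1
  else if 1 ≤ i ∧ 1 ≤ j ∧ i + k - 1 ≤ (r : ℤ) + s ∧ j + k - 1 ≤ (r : ℤ) + s then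
    ∑ᶠ L : GSys r s i j k.toNat, GSysWeight x L
  else 0

/-- `l` is a directed path from `a` to `b` along the relation `E`. -/
def IsPath {V : Type*} (E : V → V → Prop) (a b : V) (l : List V) : Prop :=
  l.IsChain E ∧ l.head? = some a ∧ l.getLast? = some b

/-- The families of pairwise vertex-disjoint paths, the `t`-th one running from `f t` to `g t`. -/
def families {V ι : Type*} (E : V → V → Prop) (f g : ι → V) : Set (ι → List V) :=
  {p | (∀ t, IsPath E (f t) (g t) (p t)) ∧ ∀ t u, t ≠ u → ∀ v ∈ p t, v ∉ p u}

/-- The product of the weights of the edges of a path. -/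
def pathWt {V : Type*} (wt : V → V → ℝ) : List V → ℝ
  | a :: b :: l => wt a b * pathWt wt (b :: l)
  | _ => 1

/-- The total weight of the families of disjoint paths from `f` to `g`. -/
noncomputable def familySum {V ι : Type*} [Fintype ι] (E : V → V → Prop) (wt : V → V → ℝ)
    (f g : ι → V) : ℝ :=
  ∑ᶠ p ∈ families E f g, ∏ t, pathWt wt (p t)

section Families

variable {V ι : Type*} {E : V → V → Prop}

lemma IsPath.eq_cons {a b : V} {l : List V} (h : IsPath E a b l) :
    l = [a] ∧ a = b ∨ ∃ u l', l = a :: u :: l' ∧ E a u ∧ IsPath E u b (u :: l') := by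
  obtain ⟨h1, h2, h3⟩ := h
  match l, h1, h2, h3 with
  | [c], _, h2, h3 => simp at h2 h3; subst h2; simp [h3]
  | c :: u :: l', h1, h2, h3 =>
    simp at h2
    subst h2
    simp at h1
    right
    exact ⟨u, l', rfl, h1.1, h1.2, by simp, by simpa using h3⟩

lemma IsPath.cons {a u b : V} {l : List V} (h : IsPath E u b l) (he : E a u) :
    IsPath E a b (a :: l) := by
  obtain ⟨h1, h2, h3⟩ := h
  match l, h1, h2, h3 with
  | c :: l', h1, h2, h3 =>
    simp at h2
    subst h2
    exact ⟨by simp [he, h1], by simp, by simpa using h3⟩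

lemma IsPath.start_mem {a b : V} {l : List V} (h : IsPath E a b l) : a ∈ l :=
  List.mem_of_mem_head? h.2.1

lemma IsPath.final_mem {a b : V} {l : List V} (h : IsPath E a b l) : b ∈ l :=
  List.mem_of_mem_getLast? h.2.2

lemma isPath_singleton (a : V) : IsPath E a a [a] := ⟨by simp, by simp, by simp⟩

lemma IsPath.mem_of_closed {U : Set V} (hU : ∀ a b, E a b → a ∈ U → b ∈ U) {a b : V}
    {l : List V} (h : IsPath E a b l) (ha : a ∈ U) : ∀ v ∈ l, v ∈ U := by
  induction l generalizing a with
  | nil => simp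
  | cons c l ih =>
    rcases h.eq_cons with ⟨h1, -⟩ | ⟨u, l', h1, h2, h3⟩
    · simp only [h1, List.mem_singleton]; rintro v rfl; exact ha
    · obtain ⟨rfl, rfl⟩ := List.cons.inj h1
      intro v hv
      rcases List.mem_cons.1 hv with rfl | hv
      · exact ha
      · exact ih h3 (hU _ _ h2 ha) v hv

lemma IsPath.length_le {L : V → ℤ} (hL : ∀ a b, E a b → L a < L b) {a b : V} {l : List V}
    (h : IsPath E a b l) : (l.length : ℤ) ≤ L b - L a + 1 := by
  induction l generalizing a with
  | nil => exact absurd h.2.1 (by simp)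
  | cons c l ih =>
    rcases h.eq_cons with ⟨h1, rfl⟩ | ⟨u, l', h1, h2, h3⟩
    · simp [h1]
    · obtain ⟨rfl, rfl⟩ := List.cons.inj h1
      have := ih h3
      have := hL _ _ h2
      simp only [List.length_cons] at *
      push_cast at *
      linarith

lemma finite_isPath {L : V → ℤ} (hL : ∀ a b, E a b → L a < L b)
    (hE : ∀ a, {u | E a u}.Finite) (a b : V) : {l | IsPath E a b l}.Finite := by
  have key : ∀ n : ℕ, ∀ a, {l : List V | IsPath E a b l ∧ l.length ≤ n}.Finite := by
    intro n
    induction n with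
    | zero =>
      intro a
      refine Set.Finite.subset (Set.finite_singleton []) ?_
      rintro l ⟨-, hl⟩
      simpa using hl
    | succ n ih =>
      intro a
      refine Set.Finite.subset ((Set.finite_singleton [a]).union
        ((hE a).biUnion fun u _ => (ih u).image (List.cons a))) ?_
      rintro l ⟨hl, hn⟩
      rcases hl.eq_cons with ⟨h1, -⟩ | ⟨u, l', rfl, h2, h3⟩
      · left; simpa using h1
      · right
        simp only [Set.mem_iUnion]
        exact ⟨u, h2, u :: l', ⟨h3, by simpa using hn⟩, rfl⟩
  refine (key (L b - L a + 1).toNat a).subset fun l hl => ⟨hl, ?_⟩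
  have := IsPath.length_le hL hl
  omega

lemma finite_families [Finite ι] {L : V → ℤ} (hL : ∀ a b, E a b → L a < L b)
    (hE : ∀ a, {u | E a u}.Finite) (f g : ι → V) : (families E f g).Finite :=
  (Set.Finite.pi' fun t => finite_isPath hL hE (f t) (g t)).subset fun _ hp => hp.1

variable [Fintype ι] {wt : V → V → ℝ} {f g : ι → V}

lemma familySum_eq_zero (h : families E f g = ∅) : familySum E wt f g = 0 := by
  simp [familySum, h]

lemma familySum_eq_zero_of_not_injective {t t' : ι} (ht : t ≠ t') (h : f t = f t') :
    familySum E wt f g = 0 := by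
  refine familySum_eq_zero (Set.eq_empty_of_forall_notMem fun p hp => ?_)
  exact hp.2 t t' ht _ (hp.1 t).start_mem (h ▸ (hp.1 t').start_mem)

lemma familySum_eq_zero_of_closed {U : Set V} (hU : ∀ a b, E a b → a ∈ U → b ∈ U) {t : ι}
    (hf : f t ∈ U) (hg : g t ∉ U) : familySum E wt f g = 0 := by
  refine familySum_eq_zero (Set.eq_empty_of_forall_notMem fun p hp => ?_)
  exact hg ((hp.1 t).mem_of_closed hU hf _ (hp.1 t).final_mem)

/-- A family starting at vertices all of whose successors lie in a closed set missed by the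
sinks is constant. -/
lemma familySum_eq_ite [DecidableEq V] {U : Set V} (hU : ∀ a b, E a b → a ∈ U → b ∈ U)
    (hf : ∀ t u, E (f t) u → u ∈ U) (hg : ∀ t, g t ∉ U) (hinj : Function.Injective f) :
    familySum E wt f g = if f = g then 1 else 0 := by
  have key : ∀ p ∈ families E f g, ∀ t, p t = [f t] ∧ f t = g t := by
    intro p hp t
    rcases (hp.1 t).eq_cons with h | ⟨u, l', h1, h2, h3⟩
    · exact h
    · exact absurd (h3.mem_of_closed hU (hf _ _ h2) _ h3.final_mem) (hg t)
  split_ifs with h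
  · subst h
    have : families E f f = {fun t => [f t]} := by
      ext p
      constructor
      · intro hp
        exact funext fun t => (key p hp t).1
      · rintro rfl
        refine ⟨fun t => isPath_singleton _, fun t t' ht v hv hv' => ht (hinj ?_)⟩
        simp at hv hv'
        rw [← hv, ← hv']
    simp [familySum, this, pathWt]
  · refine familySum_eq_zero (Set.eq_empty_of_forall_notMem fun p hp => h ?_)
    exact funext fun t => (key p hp t).2

/-- Splitting off the first edge of the path starting at `f t₀`. -/
lemma familySum_step [DecidableEq ι] (hfin : ∀ f : ι → V, (families E f g).Finite) (t₀ : ι)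
    (succ : Finset V) (hs : ∀ u, E (f t₀) u ↔ u ∈ succ) {U : Set V}
    (hU : ∀ a b, E a b → a ∈ U → b ∈ U) (hf : ∀ t, t ≠ t₀ → f t ∈ U) (hv : f t₀ ∉ U)
    (hg : f t₀ ≠ g t₀) :
    familySum E wt f g
      = ∑ u ∈ succ, wt (f t₀) u * familySum E wt (Function.update f t₀ u) g := by
  set Φ : (ι → List V) → ι → List V := fun p => Function.update p t₀ (f t₀ :: p t₀) with hΦ
  have hΦinj : Function.Injective Φ := by
    intro p q h
    funext t
    have ht := congrFun h t
    by_cases h0 : t = t₀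
    · subst h0; simpa [hΦ] using ht
    · simpa [hΦ, h0] using ht
  have hfam : families E f g = ⋃ u ∈ (succ : Set V),
      Φ '' families E (Function.update f t₀ u) g := by
    ext p
    simp only [Set.mem_iUnion, Set.mem_image]
    constructor
    · rintro ⟨h1, h2⟩
      rcases (h1 t₀).eq_cons with ⟨-, h⟩ | ⟨u, l', hl, he, hp⟩
      · exact absurd h hg
      refine ⟨u, (hs u).1 he, Function.update p t₀ (u :: l'), ⟨fun t => ?_, ?_⟩, ?_⟩
      · by_cases h0 : t = t₀
        · subst h0; simpa using hp
        · simpa [h0] using h1 t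
      · have hsub : ∀ t v, v ∈ Function.update p t₀ (u :: l') t → v ∈ p t := by
          intro t v hv
          by_cases h0 : t = t₀
          · subst h0
            rw [hl]
            simp only [Function.update_self] at hv
            exact List.mem_cons_of_mem _ hv
          · simpa [h0] using hv
        exact fun t t' ht v hv hv' => h2 t t' ht v (hsub _ _ hv) (hsub _ _ hv')
      · funext t
        by_cases h0 : t = t₀
        · subst h0; simp [hΦ, hl]
        · simp [hΦ, h0]
    · rintro ⟨u, hu, q, ⟨h1, h2⟩, rfl⟩
      have hq : ∀ t, t ≠ t₀ → f t₀ ∉ q t := by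
        intro t ht hm
        refine hv ((h1 t).mem_of_closed hU ?_ _ hm)
        simpa [ht] using hf t ht
      refine ⟨fun t => ?_, fun t t' ht v hv hv' => ?_⟩
      · by_cases h0 : t = t₀
        · subst h0
          have := h1 t
          simp only [Function.update_self] at this
          simpa [hΦ] using this.cons ((hs u).2 hu)
        · simpa [hΦ, h0] using h1 t
      · by_cases h0 : t = t₀
        · subst h0
          simp only [hΦ, Function.update_self, List.mem_cons, ne_eq, ht.symm,
            not_false_eq_true, Function.update_of_ne] at hv hv'
          rcases hv with rfl | hv
          · exact hq t' ht.symm hv'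
          · exact h2 t t' ht v hv hv'
        · by_cases h0' : t' = t₀
          · subst h0'
            simp only [hΦ, Function.update_self, List.mem_cons, ne_eq, ht,
              not_false_eq_true, Function.update_of_ne] at hv hv'
            rcases hv' with rfl | hv'
            · exact hq t ht hv
            · exact h2 t t' ht v hv hv'
          · simp only [hΦ, ne_eq, h0, h0', not_false_eq_true, Function.update_of_ne] at hv hv'
            exact h2 t t' ht v hv hv'
  rw [familySum, hfam, finsum_mem_biUnion _ succ.finite_toSet
    fun u _ => (hfin _).image Φ, finsum_mem_coe_finset]
  · refine Finset.sum_congr rfl fun u hu => ?_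
    rw [finsum_mem_image hΦinj.injOn, familySum, mul_finsum_mem]
    refine finsum_mem_congr rfl fun p hp => ?_
    have hp0 := hp.1 t₀
    rw [Function.update_self] at hp0
    rw [← Finset.mul_prod_erase _ _ (Finset.mem_univ t₀),
      ← Finset.mul_prod_erase _ (fun t => pathWt wt (p t)) (Finset.mem_univ t₀), ← mul_assoc]
    congr 1
    · obtain ⟨l, hl⟩ : ∃ l, p t₀ = u :: l := by
        rcases hp0.eq_cons with ⟨h, -⟩ | ⟨_, _, h, -⟩ <;> exact ⟨_, h⟩
      simp [hΦ, hl, pathWt]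
    · refine Finset.prod_congr rfl fun t ht => ?_
      simp [hΦ, Finset.ne_of_mem_erase ht]
  · intro u _ u' _ huu'
    refine Set.disjoint_left.2 ?_
    rintro _ ⟨p, hp, rfl⟩ ⟨q, hq, h⟩
    have := hΦinj h
    subst this
    have h1 := (hp.1 t₀).2.1
    have h2 := (hq.1 t₀).2.1
    simp only [Function.update_self] at h1 h2
    exact huu' (Option.some.inj (h1.symm.trans h2))

lemma familySum_comp_equiv {κ : Type*} [Fintype κ] (σ : κ ≃ ι) :
    familySum E wt (f ∘ σ) (g ∘ σ) = familySum E wt f g := by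
  refine finsum_mem_eq_of_bijOn (fun p => p ∘ σ.symm) ⟨?_, ?_, ?_⟩ ?_
  · rintro p ⟨h1, h2⟩
    refine ⟨fun t => by simpa using h1 (σ.symm t), fun t t' ht => h2 _ _ (by simpa using ht)⟩
  · intro p _ q _ h
    funext t
    simpa using congrFun h (σ t)
  · rintro p ⟨h1, h2⟩
    refine ⟨p ∘ σ, ⟨fun t => h1 (σ t), fun t t' ht => h2 _ _ (by simpa using ht)⟩, ?_⟩
    funext t
    simp
  · intro p _
    exact (Equiv.prod_comp σ.symm fun t => pathWt wt (p t)).symm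

lemma pathWt_concat (a b : V) (l : List V) :
    pathWt wt (l ++ [a, b]) = pathWt wt (l ++ [a]) * wt a b := by
  induction l with
  | nil => simp [pathWt]
  | cons c l ih =>
    cases l with
    | nil => simp [pathWt]
    | cons d l =>
      simp only [List.cons_append, pathWt] at ih ⊢
      rw [ih, mul_assoc]

lemma pathWt_reverse_map {φ : V → V} {wt' : V → V → ℝ}
    (hwt : ∀ a b, E a b → wt' (φ b) (φ a) = wt a b) {l : List V} (hl : l.IsChain E) :
    pathWt wt' (l.reverse.map φ) = pathWt wt l := by
  induction l with
  | nil => simp [pathWt]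
  | cons c l ih =>
    cases l with
    | nil => simp [pathWt]
    | cons d l =>
      simp only [List.isChain_cons_cons] at hl
      have h := ih hl.2
      simp only [List.reverse_cons, List.map_append, List.map_cons, List.map_nil,
        List.append_assoc, List.cons_append, List.nil_append] at h ⊢
      rw [pathWt_concat, h, hwt _ _ hl.1, pathWt, mul_comm]

/-- Families of disjoint paths are reversed by an involution that reverses the edges. -/
lemma familySum_reverse {φ : V → V} (hφ : Function.Involutive φ) {wt' : V → V → ℝ}
    {E' : V → V → Prop} (hE : ∀ a b, E a b ↔ E' (φ b) (φ a))
    (hwt : ∀ a b, E a b → wt' (φ b) (φ a) = wt a b) :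
    familySum E wt f g = familySum E' wt' (φ ∘ g) (φ ∘ f) := by
  have key : ∀ {E E' : V → V → Prop} (_ : ∀ a b, E a b ↔ E' (φ b) (φ a)) {f g : ι → V}
      {p : ι → List V}, p ∈ families E f g →
      (fun t => (p t).reverse.map φ) ∈ families E' (φ ∘ g) (φ ∘ f) := by
    intro E E' hE f g p hp
    refine ⟨fun t => ⟨?_, ?_, ?_⟩, fun t t' ht v hv hv' => ?_⟩
    · rw [List.isChain_map, List.isChain_reverse]
      exact (hp.1 t).1.imp fun a b h => (hE a b).1 h
    · simp [(hp.1 t).2.2]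
    · simp [(hp.1 t).2.1]
    · simp only [List.mem_map, List.mem_reverse] at hv hv'
      obtain ⟨a, ha, rfl⟩ := hv
      obtain ⟨b, hb, hab⟩ := hv'
      exact hp.2 t t' ht a ha (hφ.injective hab ▸ hb)
  have hinv : ∀ l : List V, (l.reverse.map φ).reverse.map φ = l := by
    intro l
    simp [hφ.comp_self]
  refine finsum_mem_eq_of_bijOn (fun p t => (p t).reverse.map φ)
    ⟨fun p hp => key hE hp, ?_, ?_⟩ ?_
  · intro p _ q _ h
    funext t
    have ht : (p t).reverse.map φ = (q t).reverse.map φ := congrFun h t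
    rw [← hinv (p t), ht, hinv]
  · intro p hp
    refine ⟨fun t => (p t).reverse.map φ, ?_, funext fun t => hinv _⟩
    have := key (E := E') (E' := E) (fun a b => by rw [hE, hφ, hφ]) hp
    simpa [← Function.comp_assoc, hφ.comp_self] using this
  · intro p hp
    exact Finset.prod_congr rfl fun t _ => (pathWt_reverse_map hwt (hp.1 t).1).symm

end Families

/-- Sum over the moves, in the last `c` columns `b + 1 - c, …, b` of a row with labels `y`, of
up-right lattice paths entering the row at the columns in `T`; `F` evaluates the columns in which
the paths leave the row. -/
noncomputable def chainRow (y : ℤ → ℝ) (b : ℤ) (F : Finset ℤ → ℝ) : ℕ → Finset ℤ → ℝ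
  | 0, T => F T
  | c + 1, T =>
    if b - c ∈ T then
      y (b - c) * (chainRow y b F c T +
        if b - c + 1 ∈ T ∨ c = 0 then 0
        else chainRow y b F c (insert (b - c + 1) (T.erase (b - c))))
    else chainRow y b F c T

/-- Total weight of the disjoint lattice paths in the last `d` rows `i₂ + 1 - d, …, i₂` of a
rectangle with columns `a, …, b`, entering at the columns in `T` and leaving at those in `B`. -/
noncomputable def chainSum (x : ℤ × ℤ → ℝ) (i₂ a b : ℤ) (B : Finset ℤ) : ℕ → Finset ℤ → ℝ
  | 0, T => if T = B then 1 else 0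
  | d + 1, T =>
    chainRow (fun j => x (i₂ - d, j)) b (chainSum x i₂ a b B d) (b + 1 - a).toNat T

/-- The analogue of `chainRow` for paths with vertical and diagonal edges. -/
noncomputable def graphRow (y : ℤ → ℝ) (a b : ℤ) (F : Finset ℤ → ℝ) : ℕ → Finset ℤ → ℝ
  | 0, S => F S
  | c + 1, S =>
    if b - c ∈ S then
      (y (b - c))⁻¹ * graphRow y a b F c S +
        if b - c - 1 ∈ S ∨ b - c ≤ a then 0
        else graphRow y a b F c (insert (b - c - 1) (S.erase (b - c)))
    else graphRow y a b F c S

/-- The analogue of `chainSum` for paths with vertical and diagonal edges. -/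
noncomputable def graphSum (x : ℤ × ℤ → ℝ) (i₂ a b : ℤ) (B : Finset ℤ) : ℕ → Finset ℤ → ℝ
  | 0, S => if S = B then 1 else 0
  | d + 1, S =>
    graphRow (fun j => x (i₂ - d, j)) a b (graphSum x i₂ a b B d) (b + 1 - a).toNat S

section Duality

lemma chainRow_eq_graphRow_aux {y : ℤ → ℝ} {a b : ℤ} {F G : Finset ℤ → ℝ} {K : ℝ}
    (hy : ∀ j, a ≤ j → j ≤ b → y j ≠ 0)
    (hFG : ∀ T ⊆ Finset.Icc a b, F T = G (Finset.Icc a b \ T) * K) (c : ℕ)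
    (hc : (c : ℤ) ≤ b - a) :
    ∀ T ⊆ Finset.Icc a b, chainRow y b F (c + 1) T
      = (if b - c ∈ T then y (b - c) else 1) * graphRow y a b G c (Finset.Icc a b \ T)
        * (∏ l ∈ Finset.Icc (b - c + 1) b, y l) * K := by
  induction c with
  | zero =>
    intro T hT
    by_cases h : b ∈ T <;> simp [chainRow, graphRow, hFG T hT, h, mul_assoc]
  | succ c ih =>
    intro T hT
    have hc' : (c : ℤ) ≤ b - a := by push_cast at hc; linarith
    have ih := ih hc'
    have hprod : ∏ l ∈ Finset.Icc (b - ((c + 1 : ℕ) : ℤ) + 1) b, y l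
        = y (b - c) * ∏ l ∈ Finset.Icc (b - c + 1) b, y l := by
      have : Finset.Icc (b - ((c + 1 : ℕ) : ℤ) + 1) b
          = insert (b - (c : ℤ)) (Finset.Icc (b - c + 1) b) := by
        ext l
        simp only [Finset.mem_Icc, Finset.mem_insert]
        push_cast
        omega
      rw [this, Finset.prod_insert (by simp)]
    have hy' : y (b - c) ≠ 0 := hy _ (by linarith) (by linarith)
    have e1 : b - ((c + 1 : ℕ) : ℤ) + 1 = b - c := by push_cast; ring
    have e2 : b - (c : ℤ) - 1 = b - ((c + 1 : ℕ) : ℤ) := by push_cast; ring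
    have mem1 : b - (c : ℤ) ∈ Finset.Icc a b := by simp; omega
    have mem2 : b - ((c + 1 : ℕ) : ℤ) ∈ Finset.Icc a b := by
      simp only [Finset.mem_Icc]; push_cast at *; omega
    rw [chainRow, graphRow, hprod, e1, e2, ih T hT]
    simp only [Finset.mem_sdiff, mem1, mem2, true_and, Nat.add_eq_zero_iff, one_ne_zero,
      and_false, or_false, show ¬ b - (c : ℤ) ≤ a by push_cast at hc; omega]
    by_cases hj : b - ((c + 1 : ℕ) : ℤ) ∈ T <;> by_cases hj' : b - (c : ℤ) ∈ T
    · simp only [hj, hj', if_true, if_false, not_true_eq_false]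
      ring
    · have hne : b - (c : ℤ) ≠ b - ((c + 1 : ℕ) : ℤ) := by push_cast; omega
      have hT' : insert (b - (c : ℤ)) (T.erase (b - ((c + 1 : ℕ) : ℤ))) ⊆ Finset.Icc a b := by
        intro z hz
        rcases Finset.mem_insert.1 hz with rfl | hz
        · exact mem1
        · exact hT (Finset.mem_of_mem_erase hz)
      have hcompl : Finset.Icc a b \ insert (b - (c : ℤ)) (T.erase (b - ((c + 1 : ℕ) : ℤ)))
          = insert (b - ((c + 1 : ℕ) : ℤ)) ((Finset.Icc a b \ T).erase (b - (c : ℤ))) := by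
        ext z
        by_cases hz : z = b - ((c + 1 : ℕ) : ℤ)
        · subst hz
          simp only [Finset.mem_sdiff, mem2, Finset.mem_insert, hne.symm, Finset.mem_erase]
          simp
        · simp only [Finset.mem_sdiff, Finset.mem_insert, Finset.mem_erase, hz]
          tauto
      rw [ih _ hT', hcompl]
      simp only [hj, hj', if_true, if_false, not_true_eq_false, not_false_eq_true,
        Finset.mem_insert_self]
      field_simp
    · simp only [hj, hj', if_true, if_false, not_true_eq_false]
      ring
    · simp only [hj, hj', if_true, if_false, not_false_eq_true]
      field_simp
      ring

lemma chainRow_eq_graphRow {y : ℤ → ℝ} {a b : ℤ} (hab : a ≤ b) {F G : Finset ℤ → ℝ} {K : ℝ}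
    (hy : ∀ j, a ≤ j → j ≤ b → y j ≠ 0)
    (hFG : ∀ T ⊆ Finset.Icc a b, F T = G (Finset.Icc a b \ T) * K) :
    ∀ T ⊆ Finset.Icc a b, chainRow y b F (b + 1 - a).toNat T
      = graphRow y a b G (b + 1 - a).toNat (Finset.Icc a b \ T)
        * ((∏ l ∈ Finset.Icc a b, y l) * K) := by
  intro T hT
  obtain ⟨c, hc⟩ : ∃ c : ℕ, (b + 1 - a).toNat = c + 1 := ⟨(b - a).toNat, by omega⟩
  have hca : b - (c : ℤ) = a := by omega
  rw [hc, chainRow_eq_graphRow_aux hy hFG c (by omega) T hT, graphRow, hca]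
  have ha : y a ≠ 0 := hy a le_rfl hab
  have hprod : ∏ l ∈ Finset.Icc a b, y l = y a * ∏ l ∈ Finset.Icc (a + 1) b, y l := by
    have : Finset.Icc a b = insert a (Finset.Icc (a + 1) b) := by
      ext l
      simp only [Finset.mem_Icc, Finset.mem_insert]
      omega
    rw [this, Finset.prod_insert (by simp)]
  rw [hprod]
  by_cases h : a ∈ T
  · simp only [h, if_true, Finset.mem_sdiff, not_true_eq_false, and_false, if_false]
    ring
  · simp only [h, if_false, Finset.mem_sdiff, not_false_eq_true, and_true, if_true, le_refl,
      or_true, Finset.mem_Icc, hab]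
    field_simp
    ring

/-- Complementary particle configurations have proportional path sums. -/
lemma chainSum_eq_graphSum {x : ℤ × ℤ → ℝ} {i₁ i₂ a b : ℤ} (hab : a ≤ b)
    (hx : ∀ i j, i₁ ≤ i → i ≤ i₂ → a ≤ j → j ≤ b → x (i, j) ≠ 0)
    (d : ℕ) (hd : (d : ℤ) ≤ i₂ + 1 - i₁) :
    ∃ K : ℝ, ∀ B ⊆ Finset.Icc a b, ∀ T ⊆ Finset.Icc a b, chainSum x i₂ a b B d T
      = graphSum x i₂ a b (Finset.Icc a b \ B) d (Finset.Icc a b \ T) * K := by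
  induction d with
  | zero =>
    refine ⟨1, fun B hB T hT => ?_⟩
    have : T = B ↔ Finset.Icc a b \ T = Finset.Icc a b \ B :=
      ⟨fun h => by rw [h], fun h => by
        rw [← Finset.sdiff_sdiff_eq_self hT, h, Finset.sdiff_sdiff_eq_self hB]⟩
    simp only [chainSum, graphSum, this, mul_one]
  | succ d ih =>
    obtain ⟨K, hK⟩ := ih (by push_cast at hd; linarith)
    exact ⟨_, fun B hB => chainRow_eq_graphRow hab
      (fun j h1 h2 => hx _ _ (by push_cast at hd; linarith) (by linarith) h1 h2) (hK B hB)⟩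

lemma chainSum_empty (x : ℤ × ℤ → ℝ) (i₂ a b : ℤ) (d : ℕ) : chainSum x i₂ a b ∅ d ∅ = 1 := by
  induction d with
  | zero => simp [chainSum]
  | succ d ih =>
    have : ∀ (y : ℤ → ℝ) (F : Finset ℤ → ℝ) c, chainRow y b F c ∅ = F ∅ := by
      intro y F c
      induction c with
      | zero => rfl
      | succ c ih => simpa [chainRow] using ih
    rw [chainSum, this, ih]

lemma graphSum_empty (x : ℤ × ℤ → ℝ) (i₂ a b : ℤ) (d : ℕ) : graphSum x i₂ a b ∅ d ∅ = 1 := by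
  induction d with
  | zero => simp [graphSum]
  | succ d ih =>
    have : ∀ (y : ℤ → ℝ) (F : Finset ℤ → ℝ) c, graphRow y a b F c ∅ = F ∅ := by
      intro y F c
      induction c with
      | zero => rfl
      | succ c ih => simpa [graphRow] using ih
    rw [graphSum, this, ih]

/-- The path sums of a rectangle are quotients of those of complementary configurations. -/
lemma chainSum_eq_div {x : ℤ × ℤ → ℝ} {i₁ i₂ a b : ℤ} (hab : a ≤ b)
    (hx : ∀ i j, i₁ ≤ i → i ≤ i₂ → a ≤ j → j ≤ b → x (i, j) ≠ 0)
    {B T : Finset ℤ} (hB : B ⊆ Finset.Icc a b) (hT : T ⊆ Finset.Icc a b) (d : ℕ)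
    (hd : (d : ℤ) ≤ i₂ + 1 - i₁) :
    chainSum x i₂ a b B d T
      = graphSum x i₂ a b (Finset.Icc a b \ B) d (Finset.Icc a b \ T)
        / graphSum x i₂ a b (Finset.Icc a b) d (Finset.Icc a b) := by
  obtain ⟨K, hK⟩ := chainSum_eq_graphSum hab hx d hd
  have h1 := hK ∅ (by simp) ∅ (by simp)
  rw [chainSum_empty, Finset.sdiff_empty] at h1
  have hne : graphSum x i₂ a b (Finset.Icc a b) d (Finset.Icc a b) ≠ 0 := by
    intro h
    simp [h] at h1
  rw [hK B hB T hT, eq_div_iff hne, mul_assoc, mul_comm K, ← h1, mul_one]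

end Duality

/-- The position of a path passing through column `c`, after the columns to the left of `j` in
row `i` have been processed. -/
def rowState (i j c : ℤ) : ℤ × ℤ := if c < j then (i + 1, c) else (i, c)

/-- The cover relation of the box `[i₁, i₂] × [a, b]`, together with the edges leaving the box
at the top. -/
def BoxStep (i₁ i₂ a b : ℤ) (p q : ℤ × ℤ) : Prop :=
  i₁ ≤ p.1 ∧ p.1 ≤ i₂ ∧ a ≤ p.2 ∧ q.2 ≤ b ∧ CoverStep p q

/-- The total weight of the families of disjoint paths from the sources `f` to the sinks `g`,
matched in an arbitrary way. -/
noncomputable def matchingSum {V ι : Type*} [Fintype ι] [DecidableEq ι] (E : V → V → Prop)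
    (wt : V → V → ℝ) (f g : ι → V) : ℝ :=
  ∑ σ : Equiv.Perm ι, familySum E wt f (g ∘ σ)

section RowStates

variable {ι : Type*}

lemma rowState_self (i j : ℤ) : rowState i j j = (i, j) := by simp [rowState]

lemma rowState_succ {i j c : ℤ} (h : c ≠ j) : rowState i (j + 1) c = rowState i j c := by
  unfold rowState
  congr 1
  simp only [eq_iff_iff]
  omega

lemma rowState_of_lt {i j c : ℤ} (h : c < j) : rowState i j c = (i + 1, c) := by
  simp [rowState, h]

lemma rowState_of_le {i j c : ℤ} (h : j ≤ c) : rowState i j c = (i, c) := by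
  simp [rowState, not_lt.2 h]

lemma update_rowState [DecidableEq ι] {i j : ℤ} {f : ι → ℤ} (hf : Function.Injective f) {t₀ : ι}
    (h : f t₀ = j) (c : ℤ) :
    Function.update (fun t => rowState i j (f t)) t₀ (rowState i (j + 1) c)
      = fun t => rowState i (j + 1) (Function.update f t₀ c t) := by
  funext t
  by_cases ht : t = t₀
  · subst ht; simp
  · simp only [ne_eq, ht, not_false_eq_true, Function.update_of_ne]
    rw [rowState_succ fun h' => ht (hf (h'.trans h.symm))]

lemma image_update [Fintype ι] [DecidableEq ι] {f : ι → ℤ} (hf : Function.Injective f) (t₀ : ι)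
    (c : ℤ) : Finset.univ.image (Function.update f t₀ c)
      = insert c ((Finset.univ.image f).erase (f t₀)) := by
  ext z
  simp only [Finset.mem_image, Finset.mem_univ, true_and, Finset.mem_insert, Finset.mem_erase]
  constructor
  · rintro ⟨t, rfl⟩
    by_cases ht : t = t₀
    · subst ht; simp
    · right
      simp only [ne_eq, ht, not_false_eq_true, Function.update_of_ne]
      exact ⟨fun h => ht (hf h), t, rfl⟩
  · rintro (rfl | ⟨hz, t, rfl⟩)
    · exact ⟨t₀, by simp⟩
    · have ht : t ≠ t₀ := fun h => hz (h ▸ rfl)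
      exact ⟨t, by simp [ht]⟩

end RowStates

section BoxPaths

variable {i₁ i₂ a b : ℤ} {k : ℕ}

lemma finite_boxStep_families (f g : Fin k → ℤ × ℤ) :
    (families (BoxStep i₁ i₂ a b) f g).Finite := by
  refine finite_families (L := fun p => p.1 + p.2) ?_ ?_ f g
  · rintro p q ⟨-, -, -, -, h⟩
    unfold CoverStep at h
    omega
  · intro p
    refine Set.Finite.subset (Set.toFinite {(p.1 + 1, p.2), (p.1, p.2 + 1)}) ?_
    rintro q ⟨-, -, -, -, h⟩
    simpa [CoverStep, Prod.ext_iff] using h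

lemma familySum_boxStep_cell {x : ℤ × ℤ → ℝ} {g : Fin k → ℤ × ℤ} (hg : ∀ t, (g t).1 = i₂ + 1)
    {i j : ℤ} (hi1 : i₁ ≤ i) (hi2 : i ≤ i₂) (hja : a ≤ j) (hjb : j ≤ b) {f : Fin k → ℤ}
    (hf : Function.Injective f) {t₀ : Fin k} (ht₀ : f t₀ = j) :
    familySum (BoxStep i₁ i₂ a b) (fun v _ => x v) (fun t => rowState i j (f t)) g
      = x (i, j) * (familySum (BoxStep i₁ i₂ a b) (fun v _ => x v)
          (fun t => rowState i (j + 1) (f t)) g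
        + if j = b then 0 else familySum (BoxStep i₁ i₂ a b) (fun v _ => x v)
          (fun t => rowState i (j + 1) (Function.update f t₀ (j + 1) t)) g) := by
  have hst : rowState i j (f t₀) = (i, j) := by rw [ht₀, rowState_self]
  rw [familySum_step (fun f => finite_boxStep_families f g) t₀
    (if j = b then {(i + 1, j)} else {(i + 1, j), (i, j + 1)})
    (U := {p | i < p.1 ∨ p.1 = i ∧ j < p.2})]
  · have e1 := update_rowState (i := i) hf ht₀ j
    have e2 := update_rowState (i := i) hf ht₀ (j + 1)
    rw [rowState_of_lt (by linarith), ← ht₀, Function.update_eq_self] at e1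
    rw [rowState_self] at e2
    rw [ht₀] at e1
    rw [hst]
    split_ifs
    · simp [e1]
    · rw [Finset.sum_pair (by simp), e1, e2, mul_add]
  · intro u
    rw [hst]
    unfold BoxStep CoverStep
    split_ifs with h <;> simp only [Finset.mem_insert, Finset.mem_singleton, Prod.ext_iff] <;>
      omega
  · rintro p q ⟨-, -, -, -, h⟩
    unfold CoverStep at h
    simp only [Set.mem_ofPred_eq]
    omega
  · intro t ht
    have : f t ≠ j := fun h => ht (hf (h.trans ht₀.symm))
    simp only [rowState, Set.mem_ofPred_eq]
    split_ifs <;> omega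
  · rw [hst]
    simp
  · rw [hst]
    intro h
    have := hg t₀
    rw [← h] at this
    dsimp only at this
    omega

lemma familySum_boxStep_row {x : ℤ × ℤ → ℝ} {g : Fin k → ℤ × ℤ} (hg : ∀ t, (g t).1 = i₂ + 1)
    {i : ℤ} (hi1 : i₁ ≤ i) (hi2 : i ≤ i₂) {F : Finset ℤ → ℝ}
    (hF : ∀ f : Fin k → ℤ, StrictMono f → (∀ t, a ≤ f t ∧ f t ≤ b) →
      familySum (BoxStep i₁ i₂ a b) (fun v _ => x v) (fun t => (i + 1, f t)) g
        = F (Finset.univ.image f)) (c : ℕ) (hc : (c : ℤ) ≤ b + 1 - a) :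
    ∀ f : Fin k → ℤ, StrictMono f → (∀ t, a ≤ f t ∧ f t ≤ b) →
      familySum (BoxStep i₁ i₂ a b) (fun v _ => x v)
          (fun t => rowState i (b + 1 - c) (f t)) g
        = chainRow (fun j => x (i, j)) b F c (Finset.univ.image f) := by
  induction c with
  | zero =>
    intro f hf hfr
    rw [chainRow, ← hF f hf hfr]
    congr 1
    funext t
    exact rowState_of_lt (by have := (hfr t).2; push_cast; linarith)
  | succ c ih =>
    have ih := ih (by push_cast at hc; linarith)
    intro f hf hfr
    have e1 : b + 1 - ((c + 1 : ℕ) : ℤ) = b - c := by push_cast; ring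
    have e2 : b + 1 - (c : ℤ) = b - c + 1 := by ring
    rw [e1, chainRow]
    rw [e2] at ih
    have hja : a ≤ b - c := by push_cast at hc; linarith
    set j := b - (c : ℤ) with hj
    by_cases hmem : j ∈ Finset.univ.image f
    · obtain ⟨t₀, -, ht₀⟩ := Finset.mem_image.1 hmem
      rw [if_pos hmem, familySum_boxStep_cell hg hi1 hi2 hja (by omega) hf.injective ht₀,
        ih f hf hfr]
      congr 2
      by_cases hc0 : c = 0
      · rw [if_pos (by omega), if_pos (Or.inr hc0)]
      rw [if_neg (by omega)]
      by_cases hmem' : j + 1 ∈ Finset.univ.image f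
      · obtain ⟨t₁, -, ht₁⟩ := Finset.mem_image.1 hmem'
        have hne : t₁ ≠ t₀ := by rintro rfl; omega
        rw [if_pos (Or.inl hmem')]
        exact familySum_eq_zero_of_not_injective hne (by simp [hne, ht₁])
      · rw [if_neg (by tauto), ih, image_update hf.injective, ht₀]
        · intro t t' htt'
          have := hf htt'
          have h1 : f t' ≠ j + 1 := fun h => hmem' (Finset.mem_image.2 ⟨t', by simp, h⟩)
          by_cases h : t = t₀
          · subst h
            rw [Function.update_self, Function.update_of_ne htt'.ne']
            omega
          · by_cases h' : t' = t₀
            · subst h'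
              rw [Function.update_self, Function.update_of_ne h]
              omega
            · rwa [Function.update_of_ne h, Function.update_of_ne h']
        · intro t
          by_cases h : t = t₀
          · subst h
            rw [Function.update_self]
            omega
          · rw [Function.update_of_ne h]
            exact hfr t
    · rw [if_neg hmem, ← ih f hf hfr]
      congr 1
      funext t
      exact (rowState_succ fun h => hmem (Finset.mem_image.2 ⟨t, by simp, h⟩)).symm

lemma familySum_boxStep {x : ℤ × ℤ → ℝ} {g : Fin k → ℤ} (hg : StrictMono g) (hab : a ≤ b)
    (d : ℕ) (hd : (d : ℤ) ≤ i₂ + 1 - i₁) :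
    ∀ f : Fin k → ℤ, StrictMono f → (∀ t, a ≤ f t ∧ f t ≤ b) →
      familySum (BoxStep i₁ i₂ a b) (fun v _ => x v) (fun t => (i₂ + 1 - d, f t))
          (fun t => (i₂ + 1, g t))
        = chainSum x i₂ a b (Finset.univ.image g) d (Finset.univ.image f) := by
  induction d with
  | zero =>
    intro f hf hfr
    rw [familySum_eq_ite (U := ∅) (by simp), chainSum]
    · congr 1
      rw [eq_iff_iff, ← Finset.coe_inj]
      simp only [Finset.coe_image, Finset.coe_univ, Set.image_univ, hf.range_inj hg]
      simp [funext_iff]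
    · rintro t u ⟨-, h, -⟩
      simp at h
    · simp
    · intro t t' h
      exact hf.injective (congrArg Prod.snd h)
  | succ d ih =>
    have ih := ih (by push_cast at hd; linarith)
    intro f hf hfr
    rw [chainSum]
    have e1 : i₂ + 1 - ((d + 1 : ℕ) : ℤ) = i₂ - d := by push_cast; ring
    have e2 : i₂ + 1 - (d : ℤ) = i₂ - d + 1 := by ring
    rw [e2] at ih
    rw [e1, ← familySum_boxStep_row (i₁ := i₁) (g := fun t => (i₂ + 1, g t)) (fun _ => rfl)
      (by push_cast at hd; linarith) (by linarith) ih _ (by omega) f hf hfr]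
    congr 1
    funext t
    exact (rowState_of_le (by have := (hfr t).1; omega)).symm

end BoxPaths

section LatticePathSystems

lemma pathWt_append_singleton {V : Type*} (x : V → ℝ) (l : List V) (u : V) :
    pathWt (fun v _ => x v) (l ++ [u]) = (l.map x).prod := by
  induction l with
  | nil => simp [pathWt]
  | cons c l ih =>
    cases l with
    | nil => simp [pathWt]
    | cons d l =>
      simp only [List.cons_append, pathWt, List.map_cons, List.prod_cons] at ih ⊢
      rw [ih]

lemma exists_rel_of_isChain_append {V : Type*} {E : V → V → Prop} {l : List V} {u : V}
    (h : (l ++ [u]).IsChain E) {v : V} (hv : v ∈ l) : ∃ v', E v v' := by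
  induction l with
  | nil => simp at hv
  | cons c l ih =>
    cases l with
    | nil =>
      simp only [List.mem_singleton] at hv
      subst hv
      exact ⟨u, by simpa using h⟩
    | cons d l =>
      simp only [List.cons_append, List.isChain_cons_cons] at h ih
      rcases List.mem_cons.1 hv with rfl | hv
      · exact ⟨d, h.1⟩
      · exact ih h.2 hv

lemma finsum_RSysWeight {i₁ i₂ a b : ℤ} (hi : i₁ ≤ i₂) (k : ℕ) (x : ℤ × ℤ → ℝ) :
    ∑ᶠ L : RSys i₁ i₂ a b k, RSysWeight x L
      = familySum (BoxStep i₁ i₂ a b) (fun v _ => x v)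
          (fun t : Fin k => (i₁, a + ((t : ℕ) : ℤ)))
          (fun t : Fin k => (i₂ + 1, b - k + 1 + ((t : ℕ) : ℤ))) := by
  rw [← finsum_mem_univ]
  refine finsum_mem_eq_of_bijOn
    (fun L t => L.path t ++ [(i₂ + 1, b - k + 1 + ((t : ℕ) : ℤ))]) ⟨?_, ?_, ?_⟩ ?_
  · rintro L -
    refine ⟨fun t => ⟨?_, ?_, by simp⟩, fun t t' ht v hv hv' => ?_⟩
    · rw [List.isChain_append]
      refine ⟨?_, by simp, ?_⟩
      · refine List.IsChain.imp_of_mem_imp ?_ (L.chain t)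
        intro p q hp hq h
        have h1 := L.mem t p hp
        have h2 := L.mem t q hq
        exact ⟨h1.1, h1.2.1, h1.2.2.1, h2.2.2.2, h⟩
      · intro p hp q hq
        rw [L.final t] at hp
        simp only [Option.mem_def, Option.some.injEq, List.head?_cons] at hp hq
        have h1 := L.mem t p (List.mem_of_mem_getLast? (by rw [L.final t, hp]; rfl))
        subst hp hq
        exact ⟨h1.1, h1.2.1, h1.2.2.1, h1.2.2.2, Or.inl ⟨rfl, rfl⟩⟩
    · rw [List.head?_append, L.first t]
      rfl
    · simp only [List.mem_append, List.mem_singleton] at hv hv'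
      rcases hv with hv | rfl <;> rcases hv' with hv' | hv'
      · exact L.disjoint t t' ht v hv hv'
      · have := (L.mem t v hv).2.1
        rw [hv'] at this
        simp at this
      · have := (L.mem t' _ hv').2.1
        simp at this
      · simp only [Prod.mk.injEq, true_and] at hv'
        exact ht (Fin.ext (by omega))
  · rintro ⟨p, _, _, _, _, _⟩ - ⟨q, _, _, _, _, _⟩ - h
    have : p = q := by
      funext t
      simpa using congrFun h t
    subst this
    rfl
  · rintro p ⟨hp, hdis⟩
    have hlast : ∀ t, (p t).dropLast ++ [(i₂ + 1, b - k + 1 + ((t : ℕ) : ℤ))] = p t :=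
      fun t => List.dropLast_append_getLast? _ (hp t).2.2
    have hchain : ∀ t, ((p t).dropLast ++ [(i₂ + 1, b - k + 1 + ((t : ℕ) : ℤ))]).IsChain
        (BoxStep i₁ i₂ a b) := fun t => by rw [hlast]; exact (hp t).1
    have hne : ∀ t, (p t).dropLast ≠ [] := by
      intro t h
      have h1 := (hp t).2.1
      rw [← hlast t, h] at h1
      simp at h1
      omega
    refine ⟨⟨fun t => (p t).dropLast, ?_, ?_, ?_, ?_, ?_⟩, Set.mem_univ _, funext hlast⟩
    · exact fun t => (hp t).1.dropLast.imp fun _ _ h => h.2.2.2.2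
    · intro t v hv
      obtain ⟨v', h1, h2, h3, h4, h5⟩ := exists_rel_of_isChain_append (hchain t) hv
      unfold CoverStep at h5
      omega
    · intro t
      have h1 := (hp t).2.1
      rw [← hlast t, List.head?_append] at h1
      rcases h : (p t).dropLast with _ | ⟨c, l⟩
      · exact absurd h (hne t)
      · rw [h] at h1
        simpa using h1
    · intro t
      have h1 := (List.isChain_append.1 (hchain t)).2.2 _
        (List.getLast?_eq_some_getLast (hne t)) _ (by simp; rfl)
      rw [List.getLast?_eq_some_getLast (hne t)]
      obtain ⟨-, h2, -, -, h5⟩ := h1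
      unfold CoverStep at h5
      simp only [Option.some.injEq, Prod.ext_iff]
      dsimp only at h5
      omega
    · exact fun t t' ht v hv hv' =>
        hdis t t' ht v (List.mem_of_mem_dropLast hv) (List.mem_of_mem_dropLast hv')
  · rintro L -
    exact Finset.prod_congr rfl fun t _ => (pathWt_append_singleton _ _ _).symm

lemma image_add_fin (a : ℤ) (k : ℕ) :
    Finset.univ.image (fun t : Fin k => a + ((t : ℕ) : ℤ)) = Finset.Icc a (a + k - 1) := by
  ext z
  simp only [Finset.mem_image, Finset.mem_univ, true_and, Finset.mem_Icc]
  constructor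
  · rintro ⟨t, rfl⟩
    omega
  · intro h
    exact ⟨⟨(z - a).toNat, by omega⟩, by dsimp only; omega⟩

lemma w_eq_chainSum {i₁ i₂ a b : ℤ} (hi : i₁ ≤ i₂) (hab : a ≤ b) {k : ℤ} (hk0 : 0 ≤ k)
    (hk : k ≤ b - a + 1) (x : ℤ × ℤ → ℝ) :
    w i₁ i₂ a b k x = chainSum x i₂ a b (Finset.Icc (b - k + 1) b) (i₂ + 1 - i₁).toNat
      (Finset.Icc a (a + k - 1)) := by
  rcases hk0.eq_or_lt with rfl | hk'
  · rw [w, if_pos le_rfl, Finset.Icc_eq_empty (by omega), Finset.Icc_eq_empty (by omega),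
      chainSum_empty]
  · have hkn : ((k.toNat : ℕ) : ℤ) = k := Int.toNat_of_nonneg hk0
    have hd : (((i₂ + 1 - i₁).toNat : ℕ) : ℤ) = i₂ + 1 - i₁ := Int.toNat_of_nonneg (by omega)
    have h := familySum_boxStep (i₁ := i₁) (i₂ := i₂) (a := a) (b := b) (x := x)
      (g := fun t : Fin k.toNat => b - k + 1 + ((t : ℕ) : ℤ))
      (fun t t' h => by simpa using h) hab (i₂ + 1 - i₁).toNat hd.le
      (fun t : Fin k.toNat => a + ((t : ℕ) : ℤ)) (fun t t' h => by simpa using h)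
      (fun t => by omega)
    rw [w, if_neg (by omega), finsum_RSysWeight hi, hkn]
    rw [image_add_fin, image_add_fin, hkn, hd] at h
    rw [show b - k + 1 + k - 1 = b by ring, show i₂ + 1 - (i₂ + 1 - i₁) = i₁ by ring] at h
    exact h

end LatticePathSystems

section GraphPaths

variable {r s : ℕ} {x : ℤ × ℤ → ℝ} {m : ℕ}

lemma finite_gEdge_families (f g : Fin m → ℤ × ℤ) : (families (GEdge r s) f g).Finite := by
  refine finite_families (L := fun p => p.1) ?_ ?_ f g
  · rintro p q ⟨-, -, -, -, h, -⟩
    omega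
  · intro p
    refine Set.Finite.subset (Set.toFinite {(p.1 + 1, p.2), (p.1 + 1, p.2 - 1)}) ?_
    rintro q ⟨-, -, -, -, h, h'⟩
    simp only [Set.mem_insert_iff, Set.mem_singleton_iff, Prod.ext_iff]
    omega

/-- Advancing one of the lowest sources along a vertical or a diagonal edge. -/
lemma familySum_gEdge_cell {f g : Fin m → ℤ × ℤ} {i j : ℤ} {t₀ : Fin m} (ht₀ : f t₀ = (i, j))
    (hi1 : 1 ≤ i) (hir : i ≤ r) (hj1 : 1 ≤ j) (hjs : j ≤ s)
    (hf : ∀ t, t ≠ t₀ → i ≤ (f t).1 ∧ f t ≠ (i, j)) (hg : g t₀ ≠ (i, j)) :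
    familySum (GEdge r s) (edgeWt x) f g
      = (x (i, j))⁻¹ * familySum (GEdge r s) (edgeWt x) (Function.update f t₀ (i + 1, j)) g
        + if j = 1 then 0
          else familySum (GEdge r s) (edgeWt x) (Function.update f t₀ (i + 1, j - 1)) g := by
  rw [familySum_step (fun f => finite_gEdge_families f g) t₀
    (if j = 1 then {(i + 1, j)} else {(i + 1, j), (i + 1, j - 1)})
    (U := {p | i ≤ p.1 ∧ p ≠ (i, j)})]
  · rw [ht₀]
    split_ifs
    · simp [edgeWt]
    · have hj : j ≠ j - 1 := by omega
      rw [Finset.sum_pair (by simpa using hj)]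
      simp [edgeWt]
  · intro u
    rw [ht₀]
    unfold GEdge
    split_ifs with h <;> simp only [Finset.mem_insert, Finset.mem_singleton, Prod.ext_iff] <;>
      omega
  · rintro p q ⟨-, -, -, -, h, -⟩ ⟨hp, -⟩
    simp only [Set.mem_ofPred_eq, ne_eq, Prod.ext_iff]
    omega
  · exact hf
  · simp [ht₀]
  · rw [ht₀]
    exact hg.symm

lemma matchingSum_rowState_cell {g : Fin m → ℤ × ℤ} {i₂ a : ℤ} (hg : ∀ t, (g t).1 = i₂ + 1)
    (hga : ∀ t, a ≤ (g t).2) {i j : ℤ} (hi1 : 1 ≤ i) (hi2 : i ≤ i₂) (hir : i₂ ≤ r) (ha : 1 ≤ a)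
    (hja : a ≤ j) (hjs : j ≤ s) {f : Fin m → ℤ} (hf : Function.Injective f) {t₀ : Fin m}
    (ht₀ : f t₀ = j) :
    matchingSum (GEdge r s) (edgeWt x) (fun t => rowState i j (f t)) g
      = (x (i, j))⁻¹ * matchingSum (GEdge r s) (edgeWt x) (fun t => rowState i (j + 1) (f t)) g
        + if j ≤ a then 0 else matchingSum (GEdge r s) (edgeWt x)
          (fun t => rowState i (j + 1) (Function.update f t₀ (j - 1) t)) g := by
  have e1 := update_rowState (i := i) hf ht₀ j
  have e2 := update_rowState (i := i) hf ht₀ (j - 1)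
  rw [rowState_of_lt (by linarith), ← ht₀, Function.update_eq_self] at e1
  rw [rowState_of_lt (by linarith)] at e2
  rw [ht₀] at e1
  have key : ∀ g : Fin m → ℤ × ℤ, (∀ t, (g t).1 = i₂ + 1) → (∀ t, a ≤ (g t).2) →
      familySum (GEdge r s) (edgeWt x) (fun t => rowState i j (f t)) g
      = (x (i, j))⁻¹ * familySum (GEdge r s) (edgeWt x) (fun t => rowState i (j + 1) (f t)) g
        + if j ≤ a then 0 else familySum (GEdge r s) (edgeWt x)
          (fun t => rowState i (j + 1) (Function.update f t₀ (j - 1) t)) g := by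
    intro g hg hga
    rw [familySum_gEdge_cell (t₀ := t₀) (by rw [ht₀, rowState_self]) hi1 (by omega) (by omega) hjs,
      e1, e2]
    · congr 1
      by_cases h : j ≤ a
      · rw [if_pos h]
        split_ifs
        · rfl
        · refine familySum_eq_zero_of_closed (U := {p | p.2 < a}) (t := t₀) ?_ ?_ ?_
          · rintro p q ⟨-, -, -, -, -, h⟩ hp
            simp only [Set.mem_ofPred_eq] at hp ⊢
            omega
          · rw [Function.update_self, rowState_of_lt (by linarith)]
            simp only [Set.mem_ofPred_eq]
            omega
          · simpa using hga t₀
      · rw [if_neg h, if_neg (by omega)]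
    · intro t ht
      have : f t ≠ j := fun h => ht (hf (h.trans ht₀.symm))
      simp only [rowState]
      split_ifs <;> simp [this]
    · intro h
      have := hg t₀
      rw [h] at this
      dsimp only at this
      omega
  simp only [matchingSum]
  rw [Finset.sum_congr rfl fun (σ : Equiv.Perm (Fin m)) _ => key (g ∘ σ) (fun t => hg _) fun t => hga _,
    Finset.sum_add_distrib, ← Finset.mul_sum]
  split_ifs <;> simp

lemma matchingSum_gEdge_row {g : Fin m → ℤ × ℤ} {i₂ a b : ℤ} (hg : ∀ t, (g t).1 = i₂ + 1)
    (hga : ∀ t, a ≤ (g t).2) {i : ℤ} (hi1 : 1 ≤ i) (hi2 : i ≤ i₂) (hir : i₂ ≤ r) (ha : 1 ≤ a)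
    (hbs : b ≤ s) {F : Finset ℤ → ℝ}
    (hF : ∀ f : Fin m → ℤ, Function.Injective f → (∀ t, a ≤ f t ∧ f t ≤ b) →
      matchingSum (GEdge r s) (edgeWt x) (fun t => (i + 1, f t)) g
        = F (Finset.univ.image f)) (c : ℕ) (hc : (c : ℤ) ≤ b + 1 - a) :
    ∀ f : Fin m → ℤ, Function.Injective f → (∀ t, a ≤ f t ∧ f t ≤ b) →
      matchingSum (GEdge r s) (edgeWt x) (fun t => rowState i (b + 1 - c) (f t)) g
        = graphRow (fun j => x (i, j)) a b F c (Finset.univ.image f) := by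
  induction c with
  | zero =>
    intro f hf hfr
    rw [graphRow, ← hF f hf hfr]
    congr 1
    funext t
    exact rowState_of_lt (by have := (hfr t).2; push_cast; linarith)
  | succ c ih =>
    have ih := ih (by push_cast at hc; linarith)
    intro f hf hfr
    have e1 : b + 1 - ((c + 1 : ℕ) : ℤ) = b - c := by push_cast; ring
    have e2 : b + 1 - (c : ℤ) = b - c + 1 := by ring
    rw [e1, graphRow]
    rw [e2] at ih
    have hja : a ≤ b - c := by push_cast at hc; linarith
    set j := b - (c : ℤ) with hj
    by_cases hmem : j ∈ Finset.univ.image f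
    · obtain ⟨t₀, -, ht₀⟩ := Finset.mem_image.1 hmem
      rw [if_pos hmem,
        matchingSum_rowState_cell hg hga hi1 hi2 hir ha hja (by omega) hf ht₀, ih f hf hfr]
      congr 1
      by_cases hja' : j ≤ a
      · rw [if_pos hja', if_pos (Or.inr hja')]
      rw [if_neg hja']
      by_cases hmem' : j - 1 ∈ Finset.univ.image f
      · obtain ⟨t₁, -, ht₁⟩ := Finset.mem_image.1 hmem'
        have hne : t₁ ≠ t₀ := by rintro rfl; omega
        rw [if_pos (Or.inl hmem')]
        exact Finset.sum_eq_zero fun σ _ =>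
          familySum_eq_zero_of_not_injective hne (by simp [hne, ht₁])
      · rw [if_neg (by tauto), ih, image_update hf, ht₀]
        · intro t t' htt'
          by_contra hne
          by_cases h : t = t₀
          · subst h
            rw [Function.update_self, Function.update_of_ne (Ne.symm hne)] at htt'
            exact hmem' (Finset.mem_image.2 ⟨t', by simp, htt'.symm⟩)
          · by_cases h' : t' = t₀
            · subst h'
              rw [Function.update_self, Function.update_of_ne h] at htt'
              exact hmem' (Finset.mem_image.2 ⟨t, by simp, htt'⟩)
            · rw [Function.update_of_ne h, Function.update_of_ne h'] at htt'
              exact hne (hf htt')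
        · intro t
          by_cases h : t = t₀
          · subst h
            rw [Function.update_self]
            omega
          · rw [Function.update_of_ne h]
            exact hfr t
    · rw [if_neg hmem, ← ih f hf hfr]
      congr 1
      funext t
      exact (rowState_succ fun h => hmem (Finset.mem_image.2 ⟨t, by simp, h⟩)).symm

lemma sum_perm_ite {α : Type*} [DecidableEq α] {f g : Fin m → α} (hf : Function.Injective f)
    (hg : Function.Injective g) :
    (∑ σ : Equiv.Perm (Fin m), if f = g ∘ σ then (1 : ℝ) else 0)
      = if Finset.univ.image f = Finset.univ.image g then 1 else 0 := by
  split_ifs with h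
  · have hex : ∀ t, ∃ t', g t' = f t := fun t => by
      have : f t ∈ Finset.univ.image g := h ▸ Finset.mem_image_of_mem f (Finset.mem_univ t)
      simpa using this
    choose e he using hex
    have hinj : Function.Injective e := fun t t' htt' => hf (by rw [← he, ← he, htt'])
    rw [Finset.sum_eq_single (Equiv.ofBijective e (Finite.injective_iff_bijective.1 hinj))]
    · rw [if_pos]
      funext t
      exact (he t).symm
    · intro σ _ hσ
      refine if_neg fun hfσ => hσ (Equiv.ext fun t => hg ?_)
      exact ((congrFun hfσ t).symm.trans (he t).symm)
    · simp
  · refine Finset.sum_eq_zero fun σ _ => if_neg fun hfσ => h ?_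
    rw [hfσ, ← Finset.coe_inj, Finset.coe_image, Finset.coe_image, Finset.coe_univ,
      Set.image_univ, Set.image_univ]
    exact σ.surjective.range_comp g

lemma matchingSum_gEdge {g : Fin m → ℤ} {i₁ i₂ a b : ℤ} (hg : Function.Injective g)
    (hga : ∀ t, a ≤ g t) (hi1 : 1 ≤ i₁) (hir : i₂ ≤ r) (ha : 1 ≤ a)
    (hab : a ≤ b) (hbs : b ≤ s) (d : ℕ) (hd : (d : ℤ) ≤ i₂ + 1 - i₁) :
    ∀ f : Fin m → ℤ, Function.Injective f → (∀ t, a ≤ f t ∧ f t ≤ b) →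
      matchingSum (GEdge r s) (edgeWt x) (fun t => (i₂ + 1 - d, f t)) (fun t => (i₂ + 1, g t))
        = graphSum x i₂ a b (Finset.univ.image g) d (Finset.univ.image f) := by
  induction d with
  | zero =>
    intro f hf hfr
    rw [graphSum, ← sum_perm_ite hf hg]
    refine Finset.sum_congr rfl fun σ _ => ?_
    rw [familySum_eq_ite (U := {p | i₂ + 1 < p.1})]
    · congr 1
      simp [funext_iff]
    · rintro p q ⟨-, -, -, -, h, -⟩ hp
      simp only [Set.mem_ofPred_eq] at hp ⊢
      omega
    · rintro t u ⟨-, -, -, -, h, -⟩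
      simp only [Set.mem_ofPred_eq]
      dsimp only at h
      omega
    · simp
    · intro t t' h
      exact hf (congrArg Prod.snd h)
  | succ d ih =>
    have ih := ih (by push_cast at hd; linarith)
    intro f hf hfr
    rw [graphSum]
    have e1 : i₂ + 1 - ((d + 1 : ℕ) : ℤ) = i₂ - d := by push_cast; ring
    have e2 : i₂ + 1 - (d : ℤ) = i₂ - d + 1 := by ring
    rw [e2] at ih
    rw [e1, ← matchingSum_gEdge_row (g := fun t => (i₂ + 1, g t)) (fun _ => rfl) hga
      (by push_cast at hd; linarith) (by linarith) hir ha hbs ih _ (by omega) f hf hfr]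
    congr 1
    funext t
    exact (rowState_of_le (by have := (hfr t).1; omega)).symm

/-- The paths issuing from consecutive boundary vertices `P_t` are forced to start with diagonal
edges until they reach the row of the last source. -/
lemma familySum_Pvert {c i : ℤ} (hi1 : 1 ≤ i) (hir : i ≤ r) (hc : i ≤ c) (hcm : c + m = s + i)
    {g : Fin m → ℤ × ℤ} (hg : ∀ t, i ≤ (g t).1) :
    familySum (GEdge r s) (edgeWt x) (fun t : Fin m => Pvert s (c + ((t : ℕ) : ℤ))) g
      = familySum (GEdge r s) (edgeWt x) (fun t : Fin m => (i, c + 1 - i + ((t : ℕ) : ℤ))) g := by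
  set S : ℤ → Fin m → ℤ × ℤ := fun ρ t =>
    if c + 1 + ((t : ℕ) : ℤ) - ρ ≤ s then (ρ, c + 1 + ((t : ℕ) : ℤ) - ρ)
    else (c + ((t : ℕ) : ℤ) - s + 1, (s : ℤ)) with hS
  have hrow : ∀ ρ : ℤ, 1 ≤ ρ → ρ < i → ∀ n : ℕ, n ≤ m →
      familySum (GEdge r s) (edgeWt x) (S ρ) g = familySum (GEdge r s) (edgeWt x)
        (fun t : Fin m => if m - n ≤ (t : ℕ) then S (ρ + 1) t else S ρ t) g := by
    intro ρ hρ1 hρ2 n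
    induction n with
    | zero =>
      intro _
      congr 1
      funext t
      rw [if_neg (by omega)]
    | succ n ih =>
      intro hn
      rw [ih (by omega)]
      set t₀ : Fin m := ⟨m - (n + 1), by omega⟩ with ht₀
      have ht₀v : (t₀ : ℕ) = m - (n + 1) := rfl
      have hlt : ∀ t : Fin m, t ≠ t₀ → (t : ℕ) ≠ m - (n + 1) := fun t ht h => ht (Fin.ext h)
      by_cases hcol : c + 1 + ((t₀ : ℕ) : ℤ) - ρ ≤ s
      · have hstart : (if m - n ≤ (t₀ : ℕ) then S (ρ + 1) t₀ else S ρ t₀)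
            = (ρ, c + 1 + ((t₀ : ℕ) : ℤ) - ρ) := by
          rw [if_neg (by omega)]
          simp only [hS]
          rw [if_pos hcol]
        rw [familySum_gEdge_cell (t₀ := t₀) hstart hρ1 (by omega) (by omega) hcol]
        · rw [if_neg (by omega), familySum_eq_zero_of_not_injective
            (t := t₀) (t' := ⟨t₀ + 1, by omega⟩), mul_zero, zero_add]
          · congr 1
            funext t
            by_cases ht : t = t₀
            · subst ht
              rw [Function.update_self, if_pos (by omega)]
              simp only [hS]
              rw [if_pos (by omega)]
              congr 1
              ring
            · have := hlt t ht
              rw [Function.update_of_ne ht]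
              congr 1
              simp only [eq_iff_iff]
              omega
          · simp [Fin.ext_iff]
          · rw [Function.update_self, Function.update_of_ne (by simp [Fin.ext_iff]),
              if_pos (by dsimp only; omega)]
            simp only [hS]
            rw [if_pos (by push_cast; omega)]
            push_cast
            congr 1
            ring
        · intro t ht
          have := hlt t ht
          simp only [hS, ne_eq, Prod.ext_iff]
          split_ifs <;> dsimp only <;> omega
        · intro h
          have := hg t₀
          rw [h] at this
          dsimp only at this
          omega
      · congr 1
        funext t
        by_cases ht : t = t₀
        · subst ht
          rw [if_neg (by omega), if_pos (by omega)]
          simp only [hS]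
          rw [if_neg hcol]
          split_ifs
          · simp only [Prod.mk.injEq]
            omega
          · rfl
        · have := hlt t ht
          congr 1
          simp only [eq_iff_iff]
          omega
  have hall : ∀ n : ℕ, (n : ℤ) ≤ i - 1 → familySum (GEdge r s) (edgeWt x) (S 1) g
      = familySum (GEdge r s) (edgeWt x) (S (1 + n)) g := by
    intro n
    induction n with
    | zero => simp
    | succ n ih =>
      intro hn
      push_cast at hn
      rw [ih (by linarith), hrow (1 + n) (by omega) (by omega) m le_rfl]
      congr 1
      funext t
      rw [if_pos (by omega)]
      congr 1
  have h1 : (fun t : Fin m => Pvert s (c + ((t : ℕ) : ℤ))) = S 1 := by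
    funext t
    simp only [hS, Pvert]
    congr 1
    · simp only [eq_iff_iff]
      omega
    · congr 1
      ring
  have h2 : S (1 + (i - 1).toNat) = fun t : Fin m => (i, c + 1 - i + ((t : ℕ) : ℤ)) := by
    funext t
    simp only [hS]
    rw [Int.toNat_of_nonneg (by omega), if_pos (by omega)]
    congr 1
    · ring
    · ring
  rw [h1, hall (i - 1).toNat (by omega), h2]

/-- The counterpart of `familySum_Pvert` for the sinks. -/
lemma familySum_Qvert {i : ℤ} (hi1 : 1 ≤ i) (hir : i ≤ r) (hm : m ≤ s) {f : Fin m → ℤ × ℤ}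
    (hf : ∀ t, (f t).1 ≤ i + 1) (σ : Equiv.Perm (Fin m)) :
    familySum (GEdge r s) (edgeWt x) f (fun t => Qvert r (i + 1 + ((σ t : ℕ) : ℤ)))
      = familySum (GEdge r s) (edgeWt x) f (fun t => (i + 1, 1 + ((σ t : ℕ) : ℤ))) := by
  set φ : ℤ × ℤ → ℤ × ℤ := fun p => (r + 2 - p.1, s + 1 - p.2) with hφ
  have hinv : Function.Involutive φ := fun p => by simp [hφ]
  have hE : ∀ p q, GEdge r s p q ↔ GEdge r s (φ q) (φ p) := by
    intro p q
    simp only [GEdge, hφ]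
    omega
  have hwt : ∀ p q, GEdge r s p q →
      edgeWt (fun p => x (r + 1 - p.1, s + 1 - p.2)) (φ q) (φ p) = edgeWt x p q := by
    rintro p q ⟨-, -, -, -, h1, h2⟩
    simp only [edgeWt, hφ]
    by_cases h : q.2 = p.2
    · rw [if_pos h, if_pos (by omega), h1, h]
      congr 2
      simp only [Prod.ext_iff]
      omega
    · rw [if_neg h, if_neg (by omega)]
  set e : Fin m ≃ Fin m := σ.trans Fin.revPerm with he
  have hev : ∀ t, ((e t : ℕ) : ℤ) = m - 1 - ((σ t : ℕ) : ℤ) := by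
    intro t
    simp only [he, Equiv.trans_apply, Fin.revPerm_apply, Fin.val_rev]
    omega
  have hP : φ ∘ (fun t => Qvert r (i + 1 + ((σ t : ℕ) : ℤ)))
      = (fun t : Fin m => Pvert s (r + s + 1 - i - m + ((t : ℕ) : ℤ))) ∘ e := by
    funext t
    simp only [Function.comp_apply, hev, Qvert, Pvert, hφ]
    split_ifs <;> simp only [Prod.ext_iff] <;> omega
  have hQ : (fun t : Fin m => ((r : ℤ) + 1 - i, r + s + 1 - i - m + 1 - (r + 1 - i)
      + ((t : ℕ) : ℤ))) ∘ e = φ ∘ (fun t => (i + 1, 1 + ((σ t : ℕ) : ℤ))) := by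
    funext t
    simp only [Function.comp_apply, hev, hφ, Prod.ext_iff]
    omega
  have hfe : φ ∘ f = (φ ∘ f ∘ e.symm) ∘ e := by
    funext t
    simp
  rw [familySum_reverse hinv hE hwt, hP, hfe, familySum_comp_equiv,
    familySum_Pvert (i := r + 1 - i) (by omega) (by omega) (by omega) (by omega),
    ← familySum_comp_equiv e, ← hfe, hQ, ← familySum_reverse hinv hE hwt]
  intro t
  have := hf (e.symm t)
  simp only [Function.comp_apply, hφ]
  omega

end GraphPaths

section GraphSystems

variable {r s : ℕ} {x : ℤ × ℤ → ℝ}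

lemma pathWt_edgeWt (l : List (ℤ × ℤ)) : pathWt (edgeWt x) l = listWt x l := by
  induction l with
  | nil => simp [pathWt, listWt]
  | cons c l ih =>
    cases l with
    | nil => simp [pathWt, listWt]
    | cons d l => simpa [pathWt, listWt] using congrArg (edgeWt x c d * ·) ih

lemma finsum_GSysWeight (i j : ℤ) (m : ℕ) :
    ∑ᶠ L : GSys r s i j m, GSysWeight x L
      = matchingSum (GEdge r s) (edgeWt x) (fun t : Fin m => Pvert s (i + ((t : ℕ) : ℤ)))
          (fun t : Fin m => Qvert r (j + ((t : ℕ) : ℤ))) := by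
  have hbij : ∀ σ : Equiv.Perm (Fin m), Set.BijOn (fun L : GSys r s i j m => L.path)
      {L | L.perm = σ} (families (GEdge r s) (fun t : Fin m => Pvert s (i + ((t : ℕ) : ℤ)))
        ((fun t : Fin m => Qvert r (j + ((t : ℕ) : ℤ))) ∘ σ)) := by
    intro σ
    refine ⟨?_, ?_, ?_⟩
    · rintro L rfl
      exact ⟨fun t => ⟨L.chain t, L.first t, L.final t⟩, L.disjoint⟩
    · rintro ⟨_, p, _, _, _, _⟩ rfl ⟨_, q, _, _, _, _⟩ h h'
      obtain rfl : _ = _ := h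
      obtain rfl : p = q := h'
      rfl
    · rintro p ⟨hp, hdis⟩
      exact ⟨⟨σ, p, fun t => (hp t).1, fun t => (hp t).2.1, fun t => (hp t).2.2, hdis⟩, rfl, rfl⟩
  have huniv : (Set.univ : Set (GSys r s i j m)) = ⋃ σ, {L | L.perm = σ} := by
    ext L
    simp
  rw [← finsum_mem_univ, huniv, finsum_mem_iUnion, finsum_eq_sum_of_fintype]
  · refine Finset.sum_congr rfl fun σ _ => ?_
    exact finsum_mem_eq_of_bijOn _ (hbij σ) fun L _ =>
      Finset.prod_congr rfl fun t _ => (pathWt_edgeWt _).symm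
  · intro σ τ hστ
    refine Set.disjoint_left.2 ?_
    rintro L rfl h
    exact hστ h
  · exact fun σ => ((hbij σ).finite_iff_finite).2 (finite_gEdge_families _ _)

lemma W_eq_graphSum {i₁ i₂ a b : ℤ} (h1 : 1 ≤ i₁) (h2 : i₁ ≤ i₂) (h3 : i₂ ≤ (r : ℤ))
    (h4 : 1 ≤ a) (h5 : a ≤ b) (h6 : b ≤ (s : ℤ))
    (hI : i₁ = 1 ∨ b = (s : ℤ)) (hI' : a = 1 ∨ i₂ = (r : ℤ)) {k : ℤ} (hk0 : 0 ≤ k)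
    (hk : k ≤ b - a + 1) :
    W r s x (i₁ + a + k - 1) (i₂ + a) (b - a - k + 1)
      = graphSum x i₂ a b (Finset.Icc a (b - k)) (i₂ + 1 - i₁).toNat
          (Finset.Icc (a + k) b) := by
  rw [W, if_neg (by omega)]
  rcases hk.eq_or_lt with rfl | hk'
  · rw [if_pos (by omega), Finset.Icc_eq_empty (by omega), Finset.Icc_eq_empty (by omega),
      graphSum_empty]
  rw [if_neg (by omega), if_pos (by omega), finsum_GSysWeight]
  set m := (b - a - k + 1).toNat with hm
  have hmz : (m : ℤ) = b - a - k + 1 := Int.toNat_of_nonneg (by omega)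
  have hd : (((i₂ + 1 - i₁).toNat : ℕ) : ℤ) = i₂ + 1 - i₁ := Int.toNat_of_nonneg (by omega)
  have key := matchingSum_gEdge (r := r) (s := s) (x := x) (i₁ := i₁) (i₂ := i₂) (a := a)
    (b := b) (g := fun t : Fin m => a + ((t : ℕ) : ℤ)) (fun t t' h => Fin.ext (by simpa using h))
    (fun t => by omega) h1 h3 h4 h5 h6 _ hd.le (fun t : Fin m => a + k + ((t : ℕ) : ℤ))
    (fun t t' h => Fin.ext (by simpa using h)) (fun t => by omega)
  rw [image_add_fin, image_add_fin, hmz, hd] at key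
  rw [show a + (b - a - k + 1) - 1 = b - k by ring,
    show a + k + (b - a - k + 1) - 1 = b by ring,
    show i₂ + 1 - (i₂ + 1 - i₁) = i₁ by ring] at key
  rw [← key]
  refine Finset.sum_congr rfl fun σ _ => ?_
  have hsource : familySum (GEdge r s) (edgeWt x)
        (fun t : Fin m => Pvert s (i₁ + a + k - 1 + ((t : ℕ) : ℤ)))
        ((fun t : Fin m => Qvert r (i₂ + a + ((t : ℕ) : ℤ))) ∘ σ)
      = familySum (GEdge r s) (edgeWt x) (fun t : Fin m => (i₁, a + k + ((t : ℕ) : ℤ)))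
        ((fun t : Fin m => Qvert r (i₂ + a + ((t : ℕ) : ℤ))) ∘ σ) := by
    rcases hI with rfl | rfl
    · congr 1
      funext t
      rw [Pvert, if_pos (by omega)]
      congr 1
      ring
    · rw [familySum_Pvert (i := i₁) h1 (by omega) (by omega) (by omega)]
      · congr 1
        funext t
        congr 1
        ring
      · intro t
        simp only [Function.comp_apply, Qvert]
        split_ifs <;> dsimp only <;> omega
  rw [hsource]
  rcases hI' with rfl | rfl
  · exact familySum_Qvert (by omega) h3 (by omega) (fun t => by dsimp only; omega) σ
  · congr 1
    funext t
    simp only [Function.comp_apply, Qvert]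
    rw [if_neg (by omega)]
    congr 1
    ring

end GraphSystems

/-- **Corollary 3.4(b).** For an interval `I = [i₁,i₂] × [j₁,j₂]` of `R = [r] × [s]`
with (`i₁ = 1` or `j₂ = s`) and (`j₁ = 1` or `i₂ = r`), and `0 ≤ k ≤ j₂ - j₁ + 1`,
`w_I^{(k)}(x) = W_{i₁+j₁+k-1, i₂+j₁}^{(j₂-j₁-k+1)}(x) / W_{i₁+j₁-1, i₂+j₁}^{(j₂-j₁+1)}(x)`. -/
theorem w_eq_W_div_W (r s : ℕ) (hr : 1 ≤ r) (hs : 1 ≤ s) (x : ℤ × ℤ → ℝ)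
    (hx : ∀ p, inR r s p → 0 < x p) (i₁ i₂ j₁ j₂ : ℤ)
    (h1 : 1 ≤ i₁) (h2 : i₁ ≤ i₂) (h3 : i₂ ≤ (r : ℤ))
    (h4 : 1 ≤ j₁) (h5 : j₁ ≤ j₂) (h6 : j₂ ≤ (s : ℤ))
    (hI : i₁ = 1 ∨ j₂ = (s : ℤ)) (hI' : j₁ = 1 ∨ i₂ = (r : ℤ))
    (k : ℤ) (hk0 : 0 ≤ k) (hk : k ≤ j₂ - j₁ + 1) :
    w i₁ i₂ j₁ j₂ k x
      = W r s x (i₁ + j₁ + k - 1) (i₂ + j₁) (j₂ - j₁ - k + 1)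
        / W r s x (i₁ + j₁ - 1) (i₂ + j₁) (j₂ - j₁ + 1) := by
  have hB : Finset.Icc (j₂ - k + 1) j₂ ⊆ Finset.Icc j₁ j₂ := Finset.Icc_subset_Icc_left (by omega)
  have hT : Finset.Icc j₁ (j₁ + k - 1) ⊆ Finset.Icc j₁ j₂ :=
    Finset.Icc_subset_Icc_right (by omega)
  have hBc : Finset.Icc j₁ j₂ \ Finset.Icc (j₂ - k + 1) j₂ = Finset.Icc j₁ (j₂ - k) := by
    ext z
    simp only [Finset.mem_sdiff, Finset.mem_Icc]
    omega
  have hTc : Finset.Icc j₁ j₂ \ Finset.Icc j₁ (j₁ + k - 1) = Finset.Icc (j₁ + k) j₂ := by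
    ext z
    simp only [Finset.mem_sdiff, Finset.mem_Icc]
    omega
  have hden := W_eq_graphSum (x := x) h1 h2 h3 h4 h5 h6 hI hI' le_rfl (by omega)
  simp only [add_zero, sub_zero] at hden
  rw [w_eq_chainSum h2 h5 hk0 hk, W_eq_graphSum h1 h2 h3 h4 h5 h6 hI hI' hk0 hk, hden,
    chainSum_eq_div (i₁ := i₁) h5 _ hB hT _ (by omega), hBc, hTc]
  intro i j hi hi' hj hj'
  exact (hx (i, j) ⟨by dsimp only; omega, by dsimp only; omega, by dsimp only; omega,
    by dsimp only; omega⟩).ne'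

end Paper
end

section
/- Let R = [r] × [s], let x ∈ ℝ_{>0}^R, let y = φ⁻¹(x), and fix (i,j) ∈ R. Then for every integer k with 0 ≤ k ≤ r + s − i − j, the (i,j)-entry of the k-th inverse iterate of birational rowmotion satisfies ρ^{−k}(y)_{ij} = W_{k+2, i+k+1}^{(j−1)}(x) / W_{k+1, i+k+1}^{(j)}(x). -/
namespace Paper

/-- The Desnanot–Jacobi identity when the determinant can be cancelled. -/
theorem desnanot_jacobi_of_isLeftRegular {R : Type*} [CommRing R] {n : ℕ}
    (A : Matrix (Fin (n + 2)) (Fin (n + 2)) R) (hA : IsLeftRegular A.det) :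
    A.det * (A.submatrix (fun i : Fin n => i.castSucc.succ) (fun i => i.castSucc.succ)).det =
      (A.submatrix Fin.castSucc Fin.castSucc).det * (A.submatrix Fin.succ Fin.succ).det -
      (A.submatrix Fin.castSucc Fin.succ).det * (A.submatrix Fin.succ Fin.castSucc).det := by
  set l : Fin (n + 2) := Fin.last (n + 1) with hl
  have h0l : (0 : Fin (n + 2)) ≠ l := by simp [hl, Fin.ext_iff]
  let U : Matrix (Fin (n + 2)) (Fin 2) R := Matrix.of fun i t =>
    if t = 0 then A.adjugate i 0 - (1 : Matrix (Fin (n + 2)) (Fin (n + 2)) R) i 0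
    else A.adjugate i l - (1 : Matrix (Fin (n + 2)) (Fin (n + 2)) R) i l
  let V : Matrix (Fin 2) (Fin (n + 2)) R := Matrix.of fun t j =>
    if t = 0 then (1 : Matrix (Fin (n + 2)) (Fin (n + 2)) R) 0 j else (1 : Matrix (Fin (n + 2)) (Fin (n + 2)) R) l j
  have hC : (1 + U * V).det =
      (A.submatrix Fin.castSucc Fin.castSucc).det * (A.submatrix Fin.succ Fin.succ).det -
      (A.submatrix Fin.castSucc Fin.succ).det * (A.submatrix Fin.succ Fin.castSucc).det := by
    rw [Matrix.det_one_add_mul_comm, Matrix.det_fin_two]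
    have e00 : (1 + V * U : Matrix (Fin 2) (Fin 2) R) 0 0 = A.adjugate 0 0 := by
      simp [V, U, Matrix.mul_apply, Matrix.one_apply]
    have e01 : (1 + V * U : Matrix (Fin 2) (Fin 2) R) 0 1 = A.adjugate 0 l := by
      simp [V, U, Matrix.mul_apply, Matrix.one_apply, h0l]
    have e10 : (1 + V * U : Matrix (Fin 2) (Fin 2) R) 1 0 = A.adjugate l 0 := by
      simp [V, U, Matrix.mul_apply, Matrix.one_apply, h0l.symm]
    have e11 : (1 + V * U : Matrix (Fin 2) (Fin 2) R) 1 1 = A.adjugate l l := by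
      simp [V, U, Matrix.mul_apply, Matrix.one_apply]
    have hs : ((-1 : R) ^ (n + 1)) * (-1) ^ (n + 1) = 1 := by
      rw [← mul_pow]; simp
    rw [e00, e01, e10, e11]
    simp only [Matrix.adjugate_fin_succ_eq_det_submatrix, hl, Fin.succAbove_last,
      Fin.succAbove_zero, Fin.val_zero, Fin.val_last, add_zero, zero_add, pow_zero, one_mul,
      pow_add]
    simp only [pow_add, pow_one] at hs
    linear_combination ((A.submatrix Fin.castSucc Fin.castSucc).det *
      (A.submatrix Fin.succ Fin.succ).det -
      (A.submatrix Fin.castSucc Fin.succ).det * (A.submatrix Fin.succ Fin.castSucc).det) * hs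
  have hAC : (A * (1 + U * V)).det = A.det * (A.det *
      (A.submatrix (fun i : Fin n => i.castSucc.succ) (fun i => i.castSucc.succ)).det) := by
    have hcol : A * (1 + U * V) = Matrix.of fun i j =>
        if j = 0 then A.det * (1 : Matrix (Fin (n + 2)) (Fin (n + 2)) R) i 0
        else if j = l then A.det * (1 : Matrix (Fin (n + 2)) (Fin (n + 2)) R) i l else A i j := by
      have hadj := Matrix.mul_adjugate A
      have hU : ∀ i t, (A * U) i t = if t = 0 then A.det * (1 : Matrix (Fin (n + 2)) (Fin (n + 2)) R) i 0 - A i 0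
          else A.det * (1 : Matrix (Fin (n + 2)) (Fin (n + 2)) R) i l - A i l := by
        intro i t
        have h1 := congrFun (congrFun hadj i) 0
        have h2 := congrFun (congrFun hadj i) l
        simp only [Matrix.mul_apply, Matrix.smul_apply, smul_eq_mul] at h1 h2 ⊢
        by_cases ht : t = 0 <;>
          simp [U, ht, mul_sub, Finset.sum_sub_distrib, h1, h2, Matrix.one_apply]
      ext i j
      rw [mul_add, mul_one, ← Matrix.mul_assoc, Matrix.add_apply, Matrix.mul_apply, Fin.sum_univ_two,
        hU, hU]
      by_cases h0 : j = 0
      · subst h0; simp [V, h0l.symm]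
      · by_cases h1 : j = l
        · subst h1; simp [V, h0l, h0]
        · simp [V, h0, h1, Ne.symm h0, Ne.symm h1]
    rw [hcol, Matrix.det_succ_column_zero, Fin.sum_univ_succ]
    simp only [Matrix.of_apply, if_true, Matrix.one_apply, Fin.succ_ne_zero, if_false, mul_zero,
      zero_mul, Finset.sum_const_zero, add_zero, mul_one, Fin.val_zero, pow_zero, one_mul]
    congr 1
    rw [Matrix.det_succ_column _ (Fin.last n), Fin.sum_univ_castSucc]
    have hlast : (Fin.last n).succ = l := rfl
    have hne : ∀ i : Fin n, i.castSucc.succ ≠ l := fun i h => by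
      have := congrArg Fin.val h
      simp [hl] at this
      omega
    have hsgn : (-1 : R) ^ (n + n) = 1 := by rw [← two_mul, pow_mul]; simp
    simp only [Matrix.submatrix_apply, Matrix.of_apply, Fin.succAbove_zero, hlast, h0l.symm,
      if_true, if_false, hne, mul_zero, zero_mul, Finset.sum_const_zero, zero_add, mul_one,
      Fin.val_last, hsgn, one_mul]
    congr 2
    ext i j
    simp [Fin.succAbove_last, hne]
  apply hA
  simp only
  rw [← hAC, Matrix.det_mul, hC]

/-- The Desnanot–Jacobi identity (Dodgson condensation). -/
theorem desnanot_jacobi {R : Type*} [CommRing R] {n : ℕ}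
    (A : Matrix (Fin (n + 2)) (Fin (n + 2)) R) :
    A.det * (A.submatrix (fun i : Fin n => i.castSucc.succ) (fun i => i.castSucc.succ)).det =
      (A.submatrix Fin.castSucc Fin.castSucc).det * (A.submatrix Fin.succ Fin.succ).det -
      (A.submatrix Fin.castSucc Fin.succ).det * (A.submatrix Fin.succ Fin.castSucc).det := by
  let X := Matrix.mvPolynomialX (Fin (n + 2)) (Fin (n + 2)) ℤ
  have hX := desnanot_jacobi_of_isLeftRegular X
    (IsRegular.of_ne_zero (Matrix.det_mvPolynomialX_ne_zero _ ℤ)).left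
  have hev : X.map (MvPolynomial.aeval fun p : Fin (n + 2) × Fin (n + 2) => A p.1 p.2) = A :=
    Matrix.mvPolynomialX_mapMatrix_aeval ℤ A
  have hsub : ∀ {m : ℕ} (f g : Fin m → Fin (n + 2)),
      MvPolynomial.aeval (fun p : Fin (n + 2) × Fin (n + 2) => A p.1 p.2) (X.submatrix f g).det =
        (A.submatrix f g).det := fun f g => by
    rw [AlgHom.map_det, AlgHom.mapMatrix_apply, ← Matrix.submatrix_map, hev]
  have hid := hsub (id : Fin (n + 2) → Fin (n + 2)) id
  simp only [Matrix.submatrix_id_id] at hid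
  have := congrArg (MvPolynomial.aeval fun p : Fin (n + 2) × Fin (n + 2) => A p.1 p.2) hX
  simpa only [map_mul, map_sub, hsub, hid] using this

/-- The lists of vertices of directed paths from `a` to `b`. -/
def dirPaths {V : Type*} (E : V → V → Prop) (a b : V) : Set (List V) :=
  {l | l.IsChain E ∧ l.head? = some a ∧ l.getLast? = some b}

/-- Tuples of pairwise vertex-disjoint directed paths from `u t` to `v t`. -/
def disjointPaths {V ι : Type*} (E : V → V → Prop) (u v : ι → V) : Set (ι → List V) :=
  {p | (∀ t, p t ∈ dirPaths E (u t) (v t)) ∧ ∀ t t', t ≠ t' → ∀ a ∈ p t, a ∉ p t'}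

/-- The product of the edge weights along a list of vertices. -/
def pathWeight {V R : Type*} [CommMonoid R] (wt : V → V → R) (l : List V) : R :=
  ((l.zip l.tail).map fun e => wt e.1 e.2).prod

/-- The total weight of all tuples of pairwise vertex-disjoint directed paths. -/
noncomputable def disjointPathSum {V ι R : Type*} [Fintype ι] [CommRing R] (E : V → V → Prop)
    (wt : V → V → R) (u v : ι → V) : R :=
  ∑ᶠ p ∈ disjointPaths E u v, ∏ t, pathWeight wt (p t)

section LGV

variable {V ι R : Type*} {E : V → V → Prop}

theorem head_mem_of_mem_dirPaths {a b : V} {l : List V} (h : l ∈ dirPaths E a b) : a ∈ l :=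
  List.mem_of_mem_head? h.2.1

theorem last_mem_of_mem_dirPaths {a b : V} {l : List V} (h : l ∈ dirPaths E a b) : b ∈ l :=
  List.mem_of_mem_getLast? h.2.2

/-- A directed path is trivial or consists of an edge followed by a directed path. -/
theorem mem_dirPaths_iff {a b : V} {l : List V} : l ∈ dirPaths E a b ↔
    (l = [a] ∧ a = b) ∨ ∃ c, E a c ∧ ∃ l' ∈ dirPaths E c b, l = a :: l' := by
  constructor
  · rintro ⟨h1, h2, h3⟩
    match l with
    | [] => simp at h2
    | [x] =>
      simp at h2 h3
      exact Or.inl ⟨by rw [h2], by rw [← h2, h3]⟩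
    | x :: y :: l =>
      simp only [List.head?_cons, Option.some.injEq] at h2
      subst h2
      rw [List.isChain_cons_cons] at h1
      exact Or.inr ⟨y, h1.1, y :: l, ⟨h1.2, rfl, by simpa using h3⟩, rfl⟩
  · rintro (⟨rfl, rfl⟩ | ⟨c, hc, l', ⟨h1, h2, h3⟩, rfl⟩)
    · exact ⟨List.isChain_singleton _, rfl, rfl⟩
    · refine ⟨List.isChain_cons.2 ⟨fun y hy => ?_, h1⟩, rfl, ?_⟩
      · rw [h2] at hy
        simp at hy
        exact hy ▸ hc
      · rw [List.getLast?_cons, h3]; rfl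

theorem dirPaths_rank_le {rk : V → ℕ} (hrk : ∀ a b, E a b → rk b < rk a) {b : V} {l : List V} :
    ∀ {a : V}, l ∈ dirPaths E a b → ∀ c ∈ l, c = a ∨ rk c < rk a := by
  induction l with
  | nil => simp
  | cons x l ih =>
    intro a h c hc
    rcases mem_dirPaths_iff.1 h with ⟨h1, -⟩ | ⟨d, hd, l', hl', h1⟩
    · rw [h1] at hc
      exact Or.inl (by simpa using hc)
    · obtain ⟨rfl, rfl⟩ := List.cons_eq_cons.1 h1
      rcases List.mem_cons.1 hc with rfl | hc
      · exact Or.inl rfl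
      · rcases ih hl' c hc with rfl | h2
        · exact Or.inr (hrk _ _ hd)
        · exact Or.inr (h2.trans (hrk _ _ hd))

theorem finite_dirPaths {rk : V → ℕ} (hrk : ∀ a b, E a b → rk b < rk a)
    (hfin : ∀ a, {b | E a b}.Finite) (a b : V) : (dirPaths E a b).Finite := by
  induction h : rk a using Nat.strong_induction_on generalizing a with
  | _ n ih =>
    refine Set.Finite.subset ((Set.finite_singleton [a]).union
      ((hfin a).biUnion (t := fun c => List.cons a '' dirPaths E c b) fun c hc =>
        (ih _ (h ▸ hrk a c hc) c rfl).image _)) fun l hl => ?_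
    rcases mem_dirPaths_iff.1 hl with ⟨h1, -⟩ | ⟨d, hd, l', hl', h1⟩
    · exact Or.inl h1
    · exact Or.inr (Set.mem_biUnion (show d ∈ {b | E a b} from hd) ⟨l', hl', h1.symm⟩)

theorem finite_disjointPaths [Finite ι] {rk : V → ℕ} (hrk : ∀ a b, E a b → rk b < rk a)
    (hfin : ∀ a, {b | E a b}.Finite) (u v : ι → V) : (disjointPaths E u v).Finite :=
  (Set.Finite.pi' fun t => finite_dirPaths hrk hfin (u t) (v t)).subset fun _ hp => hp.1

theorem pathWeight_cons [CommMonoid R] (wt : V → V → R) {a c b : V} {l : List V}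
    (hl : l ∈ dirPaths E c b) : pathWeight wt (a :: l) = wt a c * pathWeight wt l := by
  obtain ⟨-, h, -⟩ := hl
  match l with
  | [] => simp at h
  | x :: l =>
    simp only [List.head?_cons, Option.some.injEq] at h
    subst h
    simp [pathWeight]

theorem disjointPaths_eq_empty_of_not_injective {u v : ι → V} (hu : ¬ Function.Injective u) :
    disjointPaths E u v = ∅ := by
  by_contra hne
  obtain ⟨p, hp⟩ := Set.nonempty_iff_ne_empty.2 hne
  refine hu fun t t' h => ?_
  by_contra htt
  exact hp.2 t t' htt (u t) (head_mem_of_mem_dirPaths (hp.1 t))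
    (h ▸ head_mem_of_mem_dirPaths (hp.1 t'))

variable [Fintype ι] [CommRing R]

/-- Removing the first edge of the path with index `t`, whose source has maximal rank among
the sources that are not dead ends. -/
theorem disjointPathSum_step [DecidableEq ι] {rk : V → ℕ} (hrk : ∀ a b, E a b → rk b < rk a)
    (nb : V → Finset V) (hnb : ∀ a b, b ∈ nb a ↔ E a b) (wt : V → V → R) {u v : ι → V}
    (hu : Function.Injective u) (t : ι) (htv : u t ≠ v t)
    (hmax : ∀ t', (∀ b, ¬ E (u t') b) ∨ rk (u t') ≤ rk (u t)) :
    disjointPathSum E wt u v =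
      ∑ c ∈ nb (u t), wt (u t) c * disjointPathSum E wt (Function.update u t c) v := by
  have hfin : ∀ a, {b | E a b}.Finite := fun a =>
    (nb a).finite_toSet.subset fun b hb => (hnb a b).2 hb
  let f : (ι → List V) → ι → List V := fun p => Function.update p t (u t :: p t)
  have hf : Function.Injective f := fun p q h => by
    funext t'
    have := congrFun h t'
    by_cases htt : t' = t
    · subst htt; simpa [f] using this
    · simpa [f, htt] using this
  have hset : disjointPaths E u v =
      ⋃ c ∈ (nb (u t) : Set V), f '' disjointPaths E (Function.update u t c) v := by
    ext p
    simp only [Set.mem_iUnion, Set.mem_image, exists_prop, Finset.mem_coe, hnb]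
    constructor
    · intro hp
      rcases mem_dirPaths_iff.1 (hp.1 t) with ⟨-, h⟩ | ⟨c, hc, l', hl', h1⟩
      · exact absurd h htv
      · refine ⟨c, hc, Function.update p t l', ⟨fun t' => ?_, fun t' t'' hne a ha ha' => ?_⟩, ?_⟩
        · by_cases htt : t' = t
          · subst htt; simpa using hl'
          · simpa [htt] using hp.1 t'
        · have hsub : ∀ i, a ∈ Function.update p t l' i → a ∈ p i := fun i hi => by
            by_cases htt : i = t
            · subst htt
              rw [h1]
              exact List.mem_cons_of_mem _ (by simpa using hi)
            · simpa [htt] using hi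
          exact hp.2 t' t'' hne a (hsub _ ha) (hsub _ ha')
        · simp [f, ← h1]
    · rintro ⟨c, hc, q, hq, rfl⟩
      have hother : ∀ t', t' ≠ t → u t ∉ q t' := fun t' htt hmem => by
        have h1 := hq.1 t'
        simp only [Function.update_of_ne htt] at h1
        have hne : u t ≠ u t' := fun h => htt (hu h).symm
        rcases hmax t' with hd | hle
        · rcases mem_dirPaths_iff.1 h1 with ⟨h2, -⟩ | ⟨d, hd', -⟩
          · rw [h2] at hmem
            exact hne (by simpa using hmem)
          · exact hd d hd'
        · rcases dirPaths_rank_le hrk h1 _ hmem with h | h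
          · exact hne h
          · omega
      refine ⟨fun t' => ?_, fun t' t'' hne a ha ha' => ?_⟩
      · by_cases htt : t' = t
        · subst htt
          have := hq.1 t'
          simp only [Function.update_self] at this
          simp only [f, Function.update_self]
          exact mem_dirPaths_iff.2 (Or.inr ⟨c, hc, _, this, rfl⟩)
        · simpa [f, htt] using hq.1 t'
      · have hsub : ∀ i, a ∈ f q i → a ∈ q i ∨ (i = t ∧ a = u t) := fun i hi => by
          by_cases htt : i = t
          · subst htt
            simp only [f, Function.update_self, List.mem_cons] at hi
            tauto
          · simp only [f, Function.update_of_ne htt] at hi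
            exact Or.inl hi
        rcases hsub _ ha with h1 | ⟨h1, h2⟩ <;> rcases hsub _ ha' with h3 | ⟨h3, h4⟩
        · exact hq.2 _ _ hne a h1 h3
        · exact hother t' (fun h => hne (h.trans h3.symm)) (h4 ▸ h1)
        · exact hother t'' (fun h => hne (h1.trans h.symm)) (h2 ▸ h3)
        · exact hne (h1.trans h3.symm)
  have hdisj : (nb (u t) : Set V).PairwiseDisjoint
      fun c => f '' disjointPaths E (Function.update u t c) v := by
    intro c _ d _ hcd
    refine Set.disjoint_left.2 ?_
    rintro _ ⟨p, hp, rfl⟩ ⟨q, hq, hpq⟩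
    rw [hf hpq] at hq
    have h1 := (hp.1 t).2.1
    rw [(hq.1 t).2.1] at h1
    simp only [Function.update_self, Option.some.injEq] at h1
    exact hcd h1.symm
  rw [disjointPathSum, hset, finsum_mem_biUnion hdisj (nb (u t)).finite_toSet
    fun c _ => (finite_disjointPaths hrk hfin _ _).image f, finsum_mem_coe_finset]
  refine Finset.sum_congr rfl fun c _ => ?_
  rw [finsum_mem_image hf.injOn, disjointPathSum,
    mul_finsum_mem' _ _ (finite_disjointPaths hrk hfin _ _)]
  refine finsum_mem_congr rfl fun p hp => ?_
  have h1 := hp.1 t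
  simp only [Function.update_self] at h1
  rw [← Finset.mul_prod_erase _ _ (Finset.mem_univ t),
    ← Finset.mul_prod_erase _ (fun i => pathWeight wt (p i)) (Finset.mem_univ t), ← mul_assoc]
  congr 1
  · simp only [f, Function.update_self]
    exact pathWeight_cons wt h1
  · refine Finset.prod_congr rfl fun i hi => ?_
    simp only [f, Function.update_of_ne (Finset.ne_of_mem_erase hi)]

theorem disjointPathSum_of_deadEnd (wt : V → V → R) {u v : ι → V} (hu : Function.Injective u)
    (hd : ∀ t b, ¬ E (u t) b) [Decidable (u = v)] :
    disjointPathSum E wt u v = if u = v then 1 else 0 := by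
  have hp : ∀ t a, ∀ l ∈ dirPaths E (u t) a, l = [u t] ∧ u t = a := fun t a l hl => by
    rcases mem_dirPaths_iff.1 hl with h | ⟨c, hc, -⟩
    · exact h
    · exact absurd hc (hd t c)
  split_ifs with h
  · subst h
    have : disjointPaths E u u = {fun t => [u t]} := by
      ext p
      constructor
      · exact fun hq => funext fun t => (hp t _ _ (hq.1 t)).1
      · rintro rfl
        refine ⟨fun t => mem_dirPaths_iff.2 (Or.inl ⟨rfl, rfl⟩), fun t t' hne a ha ha' => ?_⟩
        simp only [List.mem_singleton] at ha ha'
        exact hne (hu (ha.symm.trans ha'))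
    rw [disjointPathSum, this, finsum_mem_singleton]
    simp [pathWeight]
  · have : disjointPaths E u v = ∅ := Set.eq_empty_iff_forall_notMem.2 fun p hq =>
      h (funext fun t => (hp t _ _ (hq.1 t)).2)
    rw [disjointPathSum, this, finsum_mem_empty]

/-- The Lindström–Gessel–Viennot lemma for sinks without outgoing edges. The array `M` is any
solution of the first-step recurrence of the path weights. -/
theorem lindstrom_gessel_viennot [DecidableEq ι] {rk : V → ℕ} (hrk : ∀ a b, E a b → rk b < rk a)
    (nb : V → Finset V) (hnb : ∀ a b, b ∈ nb a ↔ E a b) (wt : V → V → R) (v : ι → V)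
    (hv : Function.Injective v) (hd : ∀ j b, ¬ E (v j) b) (M : V → ι → R)
    (hM : ∀ a, (∀ j, a ≠ v j) → ∀ j, M a j = ∑ c ∈ nb a, wt a c * M c j)
    (u : ι → V) (hu : Function.Injective u) :
    (∑ σ : Equiv.Perm ι, ((σ.sign : ℤ) : R) * disjointPathSum E wt u (v ∘ σ)) *
      (Matrix.of fun i j => M (v i) j).det = (Matrix.of fun i j => M (u i) j).det := by
  classical
  induction h : ∑ t, rk (u t) using Nat.strong_induction_on generalizing u with
  | _ n ih =>
    by_cases hall : ∀ t, ∃ j, u t = v j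
    · choose τ hτ using hall
      have hτi : Function.Injective τ := fun a b hab => hu (by rw [hτ, hτ, hab])
      let e : Equiv.Perm ι := Equiv.ofBijective τ (Finite.injective_iff_bijective.1 hτi)
      have hue : u = v ∘ e := funext hτ
      have hde : ∀ t b, ¬ E (u t) b := fun t b => by rw [hτ]; exact hd _ _
      simp only [disjointPathSum_of_deadEnd wt hu hde]
      rw [Finset.sum_eq_single e]
      · rw [if_pos hue, mul_one, ← Matrix.det_permute]
        congr 1
        ext i j
        simp [hue]
      · intro σ _ hσ
        rw [if_neg, mul_zero]
        intro h1
        exact hσ (Equiv.ext fun i => hv (congrFun (h1.symm.trans hue) i))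
      · simp
    · push Not at hall
      obtain ⟨t, ht, hmax⟩ := Finset.exists_max_image
        (Finset.univ.filter fun t => ∀ j, u t ≠ v j) (fun t => rk (u t))
        (by obtain ⟨t, ht⟩ := hall; exact ⟨t, by simpa using ht⟩)
      simp only [Finset.mem_filter, Finset.mem_univ, true_and] at ht hmax
      have hstep : ∀ σ : Equiv.Perm ι, disjointPathSum E wt u (v ∘ σ) =
          ∑ c ∈ nb (u t), wt (u t) c *
            disjointPathSum E wt (Function.update u t c) (v ∘ σ) := fun σ => by
        refine disjointPathSum_step hrk nb hnb wt hu t (ht _) fun t' => ?_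
        by_cases h1 : ∀ j, u t' ≠ v j
        · exact Or.inr (hmax t' h1)
        · push Not at h1
          obtain ⟨j, hj⟩ := h1
          exact Or.inl fun b => hj ▸ hd j b
      have hdet : (Matrix.of fun i j => M (u i) j).det = ∑ c ∈ nb (u t), wt (u t) c *
          (Matrix.of fun i j => M (Function.update u t c i) j).det := by
        have h1 : ∀ a, (Matrix.of fun i j => M (Function.update u t a i) j) =
            (Matrix.of fun i j => M (u i) j).updateRow t (M a) := fun a => by
          ext i j
          by_cases hi : i = t
          · subst hi; simp
          · simp [hi]
        have h2 := h1 (u t)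
        rw [Function.update_eq_self] at h2
        have h3 : M (u t) = ∑ c ∈ nb (u t), wt (u t) c • M c := by
          funext j
          rw [hM _ ht j]
          simp
        rw [h2, h3]
        simp only [h1]
        have := map_sum ((Matrix.detRowAlternating (n := ι) (R := R)).toMultilinearMap.toLinearMap
          (Matrix.of fun i j => M (u i) j) t) (fun c => wt (u t) c • M c) (nb (u t))
        simp only [map_smul, smul_eq_mul] at this
        exact this
      rw [hdet]
      simp only [hstep, Finset.mul_sum, Finset.sum_mul]
      rw [Finset.sum_comm]
      refine Finset.sum_congr rfl fun c hc => ?_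
      by_cases hinj : Function.Injective (Function.update u t c)
      · have hlt : ∑ i, rk (Function.update u t c i) < n := by
          rw [← h]
          refine Finset.sum_lt_sum (fun i _ => ?_) ⟨t, Finset.mem_univ _, ?_⟩
          · by_cases hi : i = t
            · subst hi
              simpa using (hrk _ _ ((hnb _ _).1 hc)).le
            · simp [hi]
          · simpa using hrk _ _ ((hnb _ _).1 hc)
        rw [← ih _ hlt _ hinj rfl, Finset.sum_mul, Finset.mul_sum]
        exact Finset.sum_congr rfl fun σ _ => by ring
      · have h0 : (Matrix.of fun i j => M (Function.update u t c i) j).det = 0 := by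
          simp only [Function.Injective, not_forall] at hinj
          obtain ⟨i, i', h1, h2⟩ := hinj
          exact Matrix.det_zero_of_row_eq h2 (by ext j; simp [h1])
        rw [h0]
        simp [disjointPathSum, disjointPaths_eq_empty_of_not_injective hinj]

end LGV

/-- The total weight of the directed walks with `n` edges from `u` to `v` in `𝒢_R`. -/
noncomputable def walkGen (r s : ℕ) (x : ℤ × ℤ → ℝ) (v : ℤ × ℤ) : ℕ → ℤ × ℤ → ℝ
  | 0, u => if u = v then 1 else 0
  | n + 1, u => if inR r s u then (x u)⁻¹ * walkGen r s x v n (u.1 + 1, u.2) +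
      (if 2 ≤ u.2 then walkGen r s x v n (u.1 + 1, u.2 - 1) else 0) else 0

/-- The total weight of the directed paths from `u` to `v` in `𝒢_R`. -/
noncomputable def pathGen (r s : ℕ) (x : ℤ × ℤ → ℝ) (v u : ℤ × ℤ) : ℝ :=
  walkGen r s x v (v.1 - u.1).toNat u

section PathGen

variable {r s : ℕ} {x : ℤ × ℤ → ℝ}

theorem pathGen_self (v : ℤ × ℤ) : pathGen r s x v v = 1 := by
  simp [pathGen, walkGen]

theorem pathGen_eq_zero_of_row_lt {u v : ℤ × ℤ} (h : v.1 < u.1) : pathGen r s x v u = 0 := by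
  have h1 : (v.1 - u.1).toNat = 0 := by omega
  have h2 : u ≠ v := by rintro rfl; omega
  simp [pathGen, walkGen, h1, h2]

theorem pathGen_of_ne {u v : ℤ × ℤ} (h : u ≠ v) : pathGen r s x v u =
    if inR r s u then (x u)⁻¹ * pathGen r s x v (u.1 + 1, u.2) +
      (if 2 ≤ u.2 then pathGen r s x v (u.1 + 1, u.2 - 1) else 0) else 0 := by
  rcases lt_or_ge u.1 v.1 with h1 | h1
  · have h2 : (v.1 - u.1).toNat = (v.1 - (u.1 + 1)).toNat + 1 := by omega
    simp only [pathGen]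
    rw [h2, walkGen]
  · rw [pathGen_eq_zero_of_row_lt (u := (u.1 + 1, u.2)) (by simp; omega),
      pathGen_eq_zero_of_row_lt (u := (u.1 + 1, u.2 - 1)) (by simp; omega)]
    have h1 : (v.1 - u.1).toNat = 0 := by omega
    simp [pathGen, walkGen, h1, h]

theorem le_of_walkGen_ne_zero {v : ℤ × ℤ} {n : ℕ} :
    ∀ {u : ℤ × ℤ}, walkGen r s x v n u ≠ 0 →
      v.1 = u.1 + n ∧ u.1 + u.2 ≤ v.1 + v.2 ∧ v.2 ≤ u.2 := by
  induction n with
  | zero =>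
    intro u h
    have : u = v := by
      by_contra h1
      simp [walkGen, h1] at h
    subst this
    simp
  | succ n ih =>
    intro u h
    rw [walkGen] at h
    split_ifs at h with h1 h2
    · by_cases h3 : walkGen r s x v n (u.1 + 1, u.2) = 0
      · rw [h3, mul_zero, zero_add] at h
        have := ih h
        simp at this
        push_cast
        omega
      · have := ih h3
        simp at this
        push_cast
        omega
    · have := ih (right_ne_zero_of_mul (by simpa using h))
      simp at this
      push_cast
      omega
    · exact absurd rfl h

theorem le_of_pathGen_ne_zero {u v : ℤ × ℤ} (h : pathGen r s x v u ≠ 0) :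
    u.1 + u.2 ≤ v.1 + v.2 ∧ v.2 ≤ u.2 :=
  (le_of_walkGen_ne_zero h).2

theorem Qvert_content (q : ℤ) : (Qvert r q).1 + (Qvert r q).2 = q + 1 := by
  unfold Qvert
  split_ifs <;> simp; ring

theorem pathGen_Qvert_eq_one {q : ℤ} : ∀ {u : ℤ × ℤ}, 1 ≤ u.1 → u.1 ≤ r + 1 → 1 ≤ u.2 →
    u.2 ≤ s → u.1 + u.2 = q + 1 → pathGen r s x (Qvert r q) u = 1 := by
  suffices H : ∀ n : ℕ, ∀ u : ℤ × ℤ, (r + 1 - u.1).toNat = n → 1 ≤ u.1 → u.1 ≤ r + 1 → 1 ≤ u.2 →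
      u.2 ≤ s → u.1 + u.2 = q + 1 → pathGen r s x (Qvert r q) u = 1 from fun {u} => H _ u rfl
  intro n
  induction n with
  | zero =>
    intro u hn h1 h2 h3 h4 h5
    have : u = Qvert r q := by
      unfold Qvert
      rw [if_neg (by omega)]
      ext <;> simp <;> omega
    rw [← this, pathGen_self]
  | succ n ih =>
    intro u hn h1 h2 h3 h4 h5
    by_cases hu : u = Qvert r q
    · rw [← hu, pathGen_self]
    · have h6 : 2 ≤ u.2 := by
        by_contra h6
        refine hu ?_
        unfold Qvert
        rw [if_pos (by omega)]
        ext <;> simp <;> omega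
      rw [pathGen_of_ne hu, if_pos ⟨h1, by omega, h3, h4⟩, if_pos h6,
        ih (u.1 + 1, u.2 - 1) (by simp; omega) (by simp; omega) (by simp; omega) (by simp; omega)
          (by simp; omega) (by simp; omega)]
      have : pathGen r s x (Qvert r q) (u.1 + 1, u.2) = 0 := by
        by_contra h7
        have := (le_of_pathGen_ne_zero h7).1
        have := Qvert_content (r := r) q
        simp at *
        omega
      rw [this]
      simp

end PathGen

/-- The matrix of total weights of directed paths from `P_p` to `Q_q`. -/
noncomputable def pathMat (r s : ℕ) (x : ℤ × ℤ → ℝ) (p q : ℤ) : ℝ :=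
  if 1 ≤ p ∧ p ≤ r + s ∧ 1 ≤ q ∧ q ≤ r + s then pathGen r s x (Qvert r q) (Pvert s p) else 0

/-- The consecutive minor of `pathMat` of size `n` with top left corner `(a, b)`. -/
noncomputable def minor (r s : ℕ) (x : ℤ × ℤ → ℝ) (a b : ℤ) (n : ℕ) : ℝ :=
  (Matrix.of fun i j : Fin n => pathMat r s x (a + (i : ℕ)) (b + (j : ℕ))).det

section Minor

variable {r s : ℕ} {x : ℤ × ℤ → ℝ}

@[simp] theorem minor_zero (a b : ℤ) : minor r s x a b 0 = 1 := by
  simp [minor]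

theorem minor_dodgson (a b : ℤ) (n : ℕ) :
    minor r s x a b (n + 2) * minor r s x (a + 1) (b + 1) n =
      minor r s x a b (n + 1) * minor r s x (a + 1) (b + 1) (n + 1) -
      minor r s x a (b + 1) (n + 1) * minor r s x (a + 1) b (n + 1) := by
  have h := desnanot_jacobi (Matrix.of fun i j : Fin (n + 2) =>
    pathMat r s x (a + (i : ℕ)) (b + (j : ℕ)))
  unfold minor
  convert h using 3
  all_goals
    try congr 1
    try ext i j
    try simp [add_comm, add_left_comm]

theorem minor_eq_zero_of_row {a b : ℤ} {n : ℕ} (h : a < 1 ∨ r + s < a + n - 1) (hn : n ≠ 0) :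
    minor r s x a b n = 0 := by
  rcases h with h | h
  · refine Matrix.det_eq_zero_of_row_eq_zero ⟨0, by omega⟩ fun j => ?_
    simp only [Matrix.of_apply, pathMat]
    rw [if_neg]
    simp
    omega
  · refine Matrix.det_eq_zero_of_row_eq_zero ⟨n - 1, by omega⟩ fun j => ?_
    simp only [Matrix.of_apply, pathMat]
    rw [if_neg]
    simp
    omega

theorem minor_eq_zero_of_col {a b : ℤ} {n : ℕ} (h : b < 1 ∨ r + s < b + n - 1) (hn : n ≠ 0) :
    minor r s x a b n = 0 := by
  rcases h with h | h
  · refine Matrix.det_eq_zero_of_column_eq_zero ⟨0, by omega⟩ fun j => ?_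
    simp only [Matrix.of_apply, pathMat]
    rw [if_neg]
    simp
    omega
  · refine Matrix.det_eq_zero_of_column_eq_zero ⟨n - 1, by omega⟩ fun j => ?_
    simp only [Matrix.of_apply, pathMat]
    rw [if_neg]
    simp
    omega

theorem Pvert_content (t : ℤ) : (Pvert s t).1 + (Pvert s t).2 = t + 1 := by
  unfold Pvert
  split_ifs <;> simp <;> ring

theorem pathMat_eq_zero_of_lt {p q : ℤ} (h : q < p) : pathMat r s x p q = 0 := by
  unfold pathMat
  split_ifs with h1
  · by_contra h2
    have := (le_of_pathGen_ne_zero h2).1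
    rw [Pvert_content, Qvert_content] at this
    omega
  · rfl

theorem pathMat_eq_zero_of_add_lt {p q : ℤ} (h : p + r < q) : pathMat r s x p q = 0 := by
  unfold pathMat
  split_ifs with h1
  · by_contra h2
    have := (le_of_pathGen_ne_zero h2).2
    unfold Pvert Qvert at this
    split_ifs at this <;> simp at this <;> omega
  · rfl

theorem pathMat_self {p : ℤ} (h1 : 1 ≤ p) (h2 : p ≤ r + s) (hs : 1 ≤ s) :
    pathMat r s x p p = 1 := by
  unfold pathMat
  rw [if_pos (by omega)]
  apply pathGen_Qvert_eq_one
  · unfold Pvert; split_ifs <;> simp; omega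
  · unfold Pvert; split_ifs <;> simp; omega
  · unfold Pvert; split_ifs <;> simp <;> omega
  · unfold Pvert; split_ifs <;> simp; omega
  · exact Pvert_content p

theorem minor_eq_zero_of_lt {a b : ℤ} {n : ℕ} (h : b < a) (hn : n ≠ 0) :
    minor r s x a b n = 0 := by
  refine Matrix.det_eq_zero_of_column_eq_zero ⟨0, by omega⟩ fun j => ?_
  simp only [Matrix.of_apply]
  exact pathMat_eq_zero_of_lt (by simp; omega)

theorem minor_eq_zero_of_add_lt {a b : ℤ} {n : ℕ} (h : a + r < b) (hn : n ≠ 0) :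
    minor r s x a b n = 0 := by
  refine Matrix.det_eq_zero_of_row_eq_zero ⟨0, by omega⟩ fun j => ?_
  simp only [Matrix.of_apply]
  exact pathMat_eq_zero_of_add_lt (by simp; omega)

theorem minor_self {a : ℤ} {n : ℕ} (ha : 1 ≤ a) (h : a + n - 1 ≤ r + s) (hs : 1 ≤ s) :
    minor r s x a a n = 1 := by
  unfold minor
  rw [Matrix.det_of_isUpperTriangular]
  · refine Finset.prod_eq_one fun i _ => ?_
    exact pathMat_self (by omega) (by omega) hs
  · intro i j hij
    exact pathMat_eq_zero_of_lt (by simpa using hij)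

/-- More than `s` paths cannot cross a row of `𝒢_R`. -/
theorem minor_width (hs : 1 ≤ s) {a b : ℤ} (ha : 1 ≤ a) (hab : a < b) : minor r s x a b (s + 1) = 0 := by
  by_cases hb : (r : ℤ) < b
  · exact minor_eq_zero_of_col (Or.inr (by push_cast; omega)) (by omega)
  by_contra hdet
  let f : ℤ → ℤ → Fin (s + 1) → ℝ := fun m c j => pathGen r s x (Qvert r (b + (j : ℕ))) (m, c)
  let S := Submodule.span ℝ (Set.range fun t : Fin s => f (a + 1) (t + 1))
  have hf : ∀ n : ℕ, ∀ m c : ℤ, (a + 1 - m).toNat = n → 1 ≤ m → m ≤ a + 1 → 1 ≤ c → c ≤ s →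
      f m c ∈ S := by
    intro n
    induction n with
    | zero =>
      intro m c hn hm1 hm hc1 hc
      refine Submodule.subset_span ⟨⟨(c - 1).toNat, by omega⟩, ?_⟩
      have h1 : m = a + 1 := by omega
      have h2 : ((c - 1).toNat : ℤ) + 1 = c := by omega
      simp only [h1, h2]
    | succ n ih =>
      intro m c hn hm1 hm hc1 hc
      have h1 : f m c = (x (m, c))⁻¹ • f (m + 1) c + if 2 ≤ c then f (m + 1) (c - 1) else 0 := by
        ext j
        have hne : (m, c) ≠ Qvert r (b + (j : ℕ)) := by
          unfold Qvert
          split_ifs <;> simp [Prod.ext_iff] <;> omega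
        simp only [f]
        rw [pathGen_of_ne hne, if_pos ⟨hm1, by simp; omega, hc1, hc⟩]
        split_ifs <;> simp
      rw [h1]
      refine S.add_mem (S.smul_mem _ (ih _ _ (by omega) (by omega) (by omega) hc1 hc)) ?_
      split_ifs with h2
      · exact ih _ _ (by omega) (by omega) (by omega) (by omega) (by omega)
      · exact S.zero_mem
  have hli := Matrix.linearIndependent_rows_of_det_ne_zero hdet
  have hcard : Module.finrank ℝ (Submodule.span ℝ (Set.range (Matrix.of fun i j : Fin (s + 1) =>
      pathMat r s x (a + (i : ℕ)) (b + (j : ℕ))).row)) = _ := finrank_span_eq_card hli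
  have hle : Submodule.span ℝ (Set.range (Matrix.of fun i j : Fin (s + 1) =>
      pathMat r s x (a + (i : ℕ)) (b + (j : ℕ))).row) ≤ S := by
    rw [Submodule.span_le]
    rintro _ ⟨i, rfl⟩
    have hi : (Matrix.of fun i j : Fin (s + 1) =>
        pathMat r s x (a + (i : ℕ)) (b + (j : ℕ))).row i =
        f (Pvert s (a + (i : ℕ))).1 (Pvert s (a + (i : ℕ))).2 := by
      ext j
      simp only [Matrix.row, Matrix.of_apply, pathMat, f]
      rw [if_pos (by omega)]
    rw [hi]
    refine hf _ _ _ rfl ?_ ?_ ?_ ?_ <;> unfold Pvert <;> split_ifs <;> simp <;> omega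
  have h1 := Submodule.finrank_mono hle
  have h2 : Module.finrank ℝ S ≤ s := by
    simpa [Set.finrank] using finrank_range_le_card (R := ℝ) fun t : Fin s => f (a + 1) (t + 1)
  rw [hcard] at h1
  simp at h1
  omega

theorem minor_one {i j : ℕ} (hi : i ≤ r) (hj : j ≤ s) :
    minor r s x 1 (i + 1) j =
      ∏ m ∈ Finset.range i, ∏ t ∈ Finset.range j, (x ((m : ℤ) + 1, (t : ℤ) + 1))⁻¹ := by
  let A : ℕ → Matrix (Fin j) (Fin j) ℝ := fun m => Matrix.of fun t t' =>
    pathGen r s x (Qvert r (i + 1 + (t' : ℕ))) ((m : ℤ) + 1, (t : ℕ) + 1)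
  have hstep : ∀ m < i, (A m).det =
      (∏ t ∈ Finset.range j, (x ((m : ℤ) + 1, (t : ℤ) + 1))⁻¹) * (A (m + 1)).det := by
    intro m hm
    let L : Matrix (Fin j) (Fin j) ℝ := Matrix.of fun t t' =>
      if t' = t then (x ((m : ℤ) + 1, (t : ℕ) + 1))⁻¹ else if (t' : ℕ) + 1 = t then 1 else 0
    have hA : A m = L * A (m + 1) := by
      ext t t'
      have hne : ((m : ℤ) + 1, ((t : ℕ) : ℤ) + 1) ≠ Qvert r (i + 1 + (t' : ℕ)) := by
        unfold Qvert
        split_ifs <;> simp [Prod.ext_iff] <;> omega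
      simp only [A, Matrix.of_apply, Matrix.mul_apply]
      rw [pathGen_of_ne hne, if_pos ⟨by simp, by simp; omega, by simp, by simp; omega⟩]
      have hL : ∀ c : Fin j, L t c = (if c = t then (x ((m : ℤ) + 1, (t : ℕ) + 1))⁻¹ else 0) +
          if (c : ℕ) + 1 = t then 1 else 0 := by
        intro c
        simp only [L, Matrix.of_apply]
        split_ifs with h1 h2
        · subst h1; omega
        all_goals simp
      simp only [hL, add_mul, Finset.sum_add_distrib, ite_mul, zero_mul, Finset.sum_ite_eq',
        Finset.mem_univ, if_true, one_mul]
      push_cast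
      congr 1
      by_cases ht : (t : ℕ) = 0
      · rw [if_neg (by omega)]
        refine (Finset.sum_eq_zero fun c _ => ?_).symm
        rw [if_neg (by omega)]
      · rw [if_pos (by omega), Finset.sum_eq_single ⟨(t : ℕ) - 1, by omega⟩]
        · rw [if_pos (by simp; omega)]
          congr 2
          simp
          omega
        · intro c _ hc
          rw [if_neg]
          intro h
          exact hc (by ext; simp; omega)
        · simp
    have hLdet : L.det = ∏ t ∈ Finset.range j, (x ((m : ℤ) + 1, (t : ℤ) + 1))⁻¹ := by
      rw [Matrix.det_of_isLowerTriangular, ← Fin.prod_univ_eq_prod_range]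
      · simp [L]
      · intro a b hab
        have : (a : ℕ) < b := hab
        simp only [L, Matrix.of_apply]
        rw [if_neg (by rintro rfl; omega), if_neg (by omega)]
    rw [hA, Matrix.det_mul, hLdet]
  have hlast : (A i).det = 1 := by
    rw [Matrix.det_of_isUpperTriangular]
    · refine Finset.prod_eq_one fun t _ => ?_
      simp only [A, Matrix.of_apply]
      apply pathGen_Qvert_eq_one <;> simp <;> omega
    · intro a b hab
      have : (b : ℕ) < a := hab
      simp only [A, Matrix.of_apply]
      by_contra h
      have := (le_of_pathGen_ne_zero h).1
      rw [Qvert_content] at this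
      simp at this
      omega
  have hall : ∀ n ≤ i, (A 0).det =
      (∏ m ∈ Finset.range n, ∏ t ∈ Finset.range j, (x ((m : ℤ) + 1, (t : ℤ) + 1))⁻¹) *
        (A n).det := by
    intro n
    induction n with
    | zero => simp
    | succ n ih =>
      intro hn
      rw [ih (by omega), hstep n (by omega), Finset.prod_range_succ, mul_assoc]
  have h0 : minor r s x 1 (i + 1) j = (A 0).det := by
    unfold minor
    congr 1
    ext t t'
    simp only [A, Matrix.of_apply, pathMat, Pvert]
    rw [if_pos (by omega), if_pos (by omega)]
    simp [add_comm]
  rw [h0, hall i le_rfl, hlast, mul_one]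

theorem minor_pos (hs : 1 ≤ s) (hx : ∀ p, inR r s p → 0 < x p) {a b : ℤ} {n : ℕ} (ha : 1 ≤ a)
    (hab : a ≤ b) (hb : b ≤ a + r) (hn : n ≤ s) (h : b + n ≤ r + s + 1) :
    0 < minor r s x a b n := by
  obtain ⟨A, rfl⟩ : ∃ A : ℕ, a = A + 1 := ⟨(a - 1).toNat, by omega⟩
  obtain ⟨i, rfl⟩ : ∃ i : ℕ, b = A + 1 + i := ⟨(b - (A + 1)).toNat, by omega⟩
  clear ha hab
  induction A generalizing i n with
  | zero =>
    have := minor_one (x := x) (show i ≤ r by omega) hn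
    rw [show ((0 : ℕ) : ℤ) + 1 + i = i + 1 by ring, show ((0 : ℕ) : ℤ) + 1 = 1 by rfl, this]
    refine Finset.prod_pos fun m hm => Finset.prod_pos fun t ht => inv_pos.2 (hx _ ?_)
    rw [Finset.mem_range] at hm ht
    refine ⟨?_, ?_, ?_, ?_⟩ <;> simp <;> omega
  | succ A ihA =>
    induction i generalizing n with
    | zero =>
      rw [show ((A + 1 : ℕ) : ℤ) + 1 + (0 : ℕ) = (A + 1 : ℕ) + 1 by simp,
        minor_self (by omega) (by push_cast at *; omega) hs]
      exact one_pos
    | succ i ihi =>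
      induction n with
      | zero => simp
      | succ n ihn =>
        have hD := minor_dodgson (r := r) (s := s) (x := x) (A + 1) (A + 1 + (i + 1 : ℕ)) n
        push_cast at *
        have e1 : (A : ℤ) + 1 + 1 + (i + 1) = A + 1 + (i + 1) + 1 := by ring
        have e2 : (A : ℤ) + 1 + 1 + i = A + 1 + (i + 1) := by ring
        rw [e1]
        rw [e1] at ihn
        simp only [e2] at ihi
        have p1 := ihA (n := n + 1) (by omega) (i + 1) (by push_cast; omega) (by push_cast; omega)
        have p2 := ihi (n := n + 1) (by omega) (by omega) (by omega)
        have p3 := ihn (by omega) (by omega)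
        push_cast at p1
        have p4 : 0 ≤ minor r s x (A + 1) (A + 1 + (i + 1) + 1) (n + 1) := by
          by_cases hir : i + 2 ≤ r
          · have := ihA (n := n + 1) (by omega) (i + 2) (by push_cast; omega) (by push_cast; omega)
            rw [show (A : ℤ) + 1 + (i + 1) + 1 = A + 1 + (i + 2 : ℕ) by push_cast; ring]
            exact this.le
          · rw [minor_eq_zero_of_add_lt (by omega) (by omega)]
        have p5 : 0 ≤ minor r s x (A + 1) (A + 1 + (i + 1)) (n + 2) := by
          by_cases hns : n + 2 ≤ s
          · have := ihA (n := n + 2) (by omega) (i + 1) (by push_cast; omega) (by push_cast; omega)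
            push_cast at this
            exact this.le
          · rw [show n + 2 = s + 1 by omega, minor_width hs (by omega) (by omega)]
        have p6 : 0 < minor r s x (A + 1) (A + 1 + (i + 1) + 1) (n + 1) ∨
            0 < minor r s x (A + 1) (A + 1 + (i + 1)) (n + 2) := by
          by_cases hir : i + 2 ≤ r
          · have := ihA (n := n + 1) (by omega) (i + 2) (by push_cast; omega) (by push_cast; omega)
            rw [show (A : ℤ) + 1 + (i + 1) + 1 = A + 1 + (i + 2 : ℕ) by push_cast; ring]
            exact Or.inl this
          · have := ihA (n := n + 2) (by omega) (i + 1) (by push_cast; omega) (by push_cast; omega)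
            push_cast at this
            exact Or.inr this
        have : 0 < minor r s x (A + 1) (A + 1 + (i + 1)) (n + 1) *
            minor r s x (A + 1 + 1) (A + 1 + (i + 1) + 1) (n + 1) := by
          rcases p6 with p6 | p6 <;> nlinarith [mul_pos p6 p2, mul_pos p6 p3, mul_nonneg p4 p2.le,
            mul_nonneg p5 p3.le]
        exact pos_of_mul_pos_right this p1.le

end Minor

section PathSystems

theorem dirPaths_restrict {V : Type*} {E : V → V → Prop} {rk : V → ℕ}
    (hrk : ∀ a b, E a b → rk b < rk a) {T : V → Prop} {b : V} {l : List V} :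
    ∀ {a : V}, l ∈ dirPaths E a b → (∀ c ∈ l, T c → c = b) →
      l ∈ dirPaths (fun p q => E p q ∧ ¬ T p) a b := by
  induction l with
  | nil => intro a h; simp [dirPaths] at h
  | cons y l ih =>
    intro a h hT
    rcases mem_dirPaths_iff.1 h with h1 | ⟨d, hd, l', hl', h1⟩
    · exact mem_dirPaths_iff.2 (Or.inl h1)
    · obtain ⟨rfl, rfl⟩ := List.cons_eq_cons.1 h1
      refine mem_dirPaths_iff.2 (Or.inr ⟨d, ⟨hd, fun hy => ?_⟩, l, ?_, rfl⟩)
      · have hyb := hT y (by simp) hy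
        rcases dirPaths_rank_le hrk hl' b (last_mem_of_mem_dirPaths hl') with h2 | h2
        · have := hrk _ _ hd
          rw [← h2, hyb] at this
          exact lt_irrefl _ this
        · have := hrk _ _ hd
          rw [hyb] at this
          exact lt_asymm h2 this
      · exact ih hl' fun c hc => hT c (List.mem_cons_of_mem _ hc)

theorem dirPaths_mono {V : Type*} {E E' : V → V → Prop} (h : ∀ a b, E a b → E' a b) {a b : V}
    {l : List V} (hl : l ∈ dirPaths E a b) : l ∈ dirPaths E' a b :=
  ⟨hl.1.imp h, hl.2⟩

variable {r s : ℕ} {x : ℤ × ℤ → ℝ}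

theorem content_le_of_mem_dirPaths {b : ℤ × ℤ} {l : List (ℤ × ℤ)} :
    ∀ {a : ℤ × ℤ}, l ∈ dirPaths (GEdge r s) a b → a.1 + a.2 ≤ b.1 + b.2 := by
  induction l with
  | nil => intro a h; simp [dirPaths] at h
  | cons y l ih =>
    intro a h
    rcases mem_dirPaths_iff.1 h with ⟨-, rfl⟩ | ⟨d, hd, l', hl', h1⟩
    · exact le_rfl
    · obtain ⟨rfl, rfl⟩ := List.cons_eq_cons.1 h1
      have h1 := ih hl'
      unfold GEdge at hd
      omega

/-- Disjoint directed paths in `𝒢_R` ending on the boundary do not cross. -/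
theorem lt_of_disjoint_dirPaths {q q' : ℤ} {l : List (ℤ × ℤ)} :
    ∀ {l' : List (ℤ × ℤ)} {u u' : ℤ × ℤ}, l ∈ dirPaths (GEdge r s) u (Qvert r q) →
      l' ∈ dirPaths (GEdge r s) u' (Qvert r q') → (∀ a ∈ l, a ∉ l') →
      ((u.1 = u'.1 ∧ u.2 < u'.2) ∨ (u.1 < u'.1 ∧ u'.2 = s ∧ u.2 ≤ s)) → q < q' := by
  induction l with
  | nil => intro l' u u' h; simp [dirPaths] at h
  | cons y l ih =>
    intro l' u u' hl hl' hd hu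
    rcases mem_dirPaths_iff.1 hl with ⟨-, rfl⟩ | ⟨d, hd1, m, hm, h1⟩
    · have h1 := content_le_of_mem_dirPaths hl'
      rw [Qvert_content] at h1
      have h2 := Qvert_content (r := r) q
      omega
    · obtain ⟨rfl, rfl⟩ := List.cons_eq_cons.1 h1
      have hdl : d ∈ l := head_mem_of_mem_dirPaths hm
      unfold GEdge at hd1
      rcases hu with hu | hu
      · rcases mem_dirPaths_iff.1 hl' with ⟨-, rfl⟩ | ⟨d', hd1', m', hm', rfl⟩
        · exfalso
          revert hu
          unfold Qvert
          split_ifs <;> simp <;> omega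
        · have hdl' : d' ∈ m' := head_mem_of_mem_dirPaths hm'
          refine ih hm hm' (fun a ha ha' =>
            hd a (List.mem_cons_of_mem _ ha) (List.mem_cons_of_mem _ ha')) (Or.inl ?_)
          have hne : d ≠ d' := by
            rintro rfl
            exact hd d (List.mem_cons_of_mem _ hdl) (List.mem_cons_of_mem _ hdl')
          unfold GEdge at hd1'
          have : ¬ (d.1 = d'.1 ∧ d.2 = d'.2) := fun h => hne (Prod.ext h.1 h.2)
          omega
      · refine ih hm hl' (fun a ha => hd a (List.mem_cons_of_mem _ ha)) ?_
        have hne : d ≠ u' := by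
          rintro rfl
          exact hd d (List.mem_cons_of_mem _ hdl) (head_mem_of_mem_dirPaths hl')
        have : ¬ (d.1 = u'.1 ∧ d.2 = u'.2) := fun h => hne (Prod.ext h.1 h.2)
        omega

theorem perm_eq_one_of_disjoint {a b : ℤ} {n : ℕ} {σ : Equiv.Perm (Fin n)}
    {p : Fin n → List (ℤ × ℤ)} (hp : p ∈ disjointPaths (GEdge r s)
      (fun t : Fin n => Pvert s (a + ((t : ℕ) : ℤ))) (fun t => Qvert r (b + ((σ t : ℕ) : ℤ)))) :
    σ = 1 := by
  have hσ : StrictMono σ := by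
    intro t t' htt
    have h : (t : ℕ) < t' := htt
    have := lt_of_disjoint_dirPaths (hp.1 t) (hp.1 t') (hp.2 t t' htt.ne) (by
      unfold Pvert
      beta_reduce
      split_ifs <;> simp <;> omega)
    have h2 : (σ t : ℕ) < σ t' := by omega
    exact h2
  ext1 t
  exact congrFun (hσ.range_inj strictMono_id |>.1 (by simp [σ.surjective.range_eq])) t

theorem GEdge_rank (a b : ℤ × ℤ) (h : GEdge r s a b) :
    (r + 1 - b.1).toNat < (r + 1 - a.1).toNat := by
  unfold GEdge at h
  omega

/-- Collections of disjoint paths in `𝒢_R` are counted by minors of the path matrix. -/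
theorem finsum_GSysWeight_s6 {a b : ℤ} {n : ℕ} (ha : 1 ≤ a) (hb : 1 ≤ b) (han : a + n - 1 ≤ r + s)
    (hbn : b + n - 1 ≤ r + s) :
    ∑ᶠ L : GSys r s a b n, GSysWeight x L = minor r s x a b n := by
  classical
  let u : Fin n → ℤ × ℤ := fun t => Pvert s (a + ((t : ℕ) : ℤ))
  let v : Fin n → ℤ × ℤ := fun t => Qvert r (b + ((t : ℕ) : ℤ))
  let T : ℤ × ℤ → Prop := fun c => ∃ j, c = v j
  let E : ℤ × ℤ → ℤ × ℤ → Prop := fun p q => GEdge r s p q ∧ ¬ T p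
  have hu : Function.Injective u := by
    intro t t' h
    have h1 : u t = u t' := h
    have h2 := Pvert_content (s := s) (a + ((t : ℕ) : ℤ))
    have h3 := Pvert_content (s := s) (a + ((t' : ℕ) : ℤ))
    simp only [u] at h1
    rw [h1] at h2
    ext
    omega
  have hv : Function.Injective v := by
    intro t t' h
    have h1 : v t = v t' := h
    have h2 := Qvert_content (r := r) (b + ((t : ℕ) : ℤ))
    have h3 := Qvert_content (r := r) (b + ((t' : ℕ) : ℤ))
    simp only [v] at h1
    rw [h1] at h2
    ext
    omega
  have hrange : Set.range (GSys.path : GSys r s a b n → _) = disjointPaths E u v := by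
    ext p
    constructor
    · rintro ⟨L, rfl⟩
      have hL : ∀ t : Fin n, L.path t ∈ dirPaths (GEdge r s) (Pvert s (a + ((t : ℕ) : ℤ)))
          (Qvert r (b + ((L.perm t : ℕ) : ℤ))) := fun t => ⟨L.chain t, L.first t, L.final t⟩
      have h1 := perm_eq_one_of_disjoint ⟨hL, L.disjoint⟩
      rw [h1] at hL
      refine ⟨fun t => dirPaths_restrict GEdge_rank (hL t) ?_, L.disjoint⟩
      rintro c hc ⟨j, rfl⟩
      by_cases hj : t = j
      · rw [← hj]
      · exact absurd (last_mem_of_mem_dirPaths (hL j)) (L.disjoint t j hj _ hc)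
    · intro hp
      have hp1 : ∀ t, p t ∈ dirPaths (GEdge r s) (u t) (v t) :=
        fun t => dirPaths_mono (fun _ _ h => h.1) (hp.1 t)
      exact ⟨⟨1, p, fun t => (hp1 t).1, fun t => (hp1 t).2.1, fun t => (hp1 t).2.2, hp.2⟩, rfl⟩
  have hinj : Function.Injective (GSys.path : GSys r s a b n → _) := by
    intro L L' h
    have h1 := perm_eq_one_of_disjoint (p := L.path) (σ := L.perm)
      ⟨fun t => ⟨L.chain t, L.first t, L.final t⟩, L.disjoint⟩
    have h2 := perm_eq_one_of_disjoint (p := L'.path) (σ := L'.perm)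
      ⟨fun t => ⟨L'.chain t, L'.first t, L'.final t⟩, L'.disjoint⟩
    cases L
    cases L'
    simp only at h h1 h2
    subst h h1 h2
    rfl
  have hsum : ∑ᶠ L : GSys r s a b n, GSysWeight x L = disjointPathSum E (edgeWt x) u v := by
    unfold disjointPathSum
    rw [← hrange, finsum_mem_range hinj]
    rfl
  have hlgv := lindstrom_gessel_viennot (E := E) (rk := fun c => (r + 1 - c.1).toNat)
    (fun p q h => GEdge_rank p q h.1)
    (fun c => if T c then ∅ else if inR r s c then
      (if 2 ≤ c.2 then {(c.1 + 1, c.2), (c.1 + 1, c.2 - 1)} else {(c.1 + 1, c.2)}) else ∅)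
    (by
      rintro p ⟨q1, q2⟩
      by_cases hT : T p
      · simp [E, hT]
      · by_cases hp : inR r s p
        · simp only [E, hT, hp, if_true, if_false, not_false_eq_true, and_true]
          unfold inR at hp
          unfold GEdge
          split_ifs with h2 <;> simp <;> omega
        · simp only [E, hT, hp, if_false, not_false_eq_true, and_true]
          unfold inR at hp
          unfold GEdge
          simp
          omega)
    (edgeWt x) v hv (fun j c h => h.2 ⟨j, rfl⟩) (fun c j => pathGen r s x (v j) c)
    (by
      intro c hc j
      have hT : ¬ T c := fun ⟨j, hj⟩ => hc j hj
      rw [pathGen_of_ne (hc j)]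
      by_cases hR : inR r s c
      · rw [if_neg hT, if_pos hR, if_pos hR]
        split_ifs with h2
        · rw [Finset.sum_pair fun h => by
            have := congrArg Prod.snd h
            simp only at this
            omega]
          simp [edgeWt]
        · simp [edgeWt]
      · rw [if_neg hT, if_neg hR, if_neg hR]
        simp)
    u hu
  have hdet1 : (Matrix.of fun i j => pathGen r s x (v j) (v i)).det = 1 := by
    rw [Matrix.det_of_isUpperTriangular]
    · exact Finset.prod_eq_one fun i _ => pathGen_self _
    · intro i j hij
      have hij : (j : ℕ) < i := hij
      simp only [Matrix.of_apply]
      by_contra h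
      have := (le_of_pathGen_ne_zero h).1
      simp only [v] at this
      rw [Qvert_content, Qvert_content] at this
      omega
  rw [hdet1, mul_one, Finset.sum_eq_single 1] at hlgv
  · rw [hsum]
    simp only [Equiv.Perm.sign_one, Units.val_one, Int.cast_one, one_mul] at hlgv
    refine hlgv.trans ?_
    unfold minor
    congr 1
    ext i j
    simp only [Matrix.of_apply, pathMat]
    rw [if_pos (by omega)]
  · intro σ _ hσ
    have : disjointPaths E u (v ∘ σ) = ∅ := by
      rw [Set.eq_empty_iff_forall_notMem]
      intro p hp
      exact hσ (perm_eq_one_of_disjoint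
        ⟨fun t => dirPaths_mono (fun _ _ h => h.1) (hp.1 t), hp.2⟩)
    simp [disjointPathSum, this]
  · simp

theorem W_natCast (a b : ℤ) (n : ℕ) : W r s x a b n = minor r s x a b n := by
  unfold W
  rw [if_neg (by omega)]
  rcases Nat.eq_zero_or_pos n with rfl | hn
  · simp
  · rw [if_neg (by omega)]
    split_ifs with h
    · exact finsum_GSysWeight_s6 h.1 h.2.1 h.2.2.1 h.2.2.2
    · by_cases h1 : 1 ≤ a ∧ a + n - 1 ≤ r + s
      · exact (minor_eq_zero_of_col (by omega) (by omega)).symm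
      · exact (minor_eq_zero_of_row (by omega) (by omega)).symm

end PathSystems

section Rowmotion

variable {r s : ℕ} {x : ℤ × ℤ → ℝ}

theorem dsum_eq (y : ℤ × ℤ → ℝ) {p : ℤ × ℤ} (hp : inR r s p) : dsum r s y p =
    if p.1 = 1 ∧ p.2 = 1 then 1 else
      (if 2 ≤ p.1 then y (p.1 - 1, p.2) else 0) + if 2 ≤ p.2 then y (p.1, p.2 - 1) else 0 := by
  unfold inR at hp
  have h1 : inR r s (p.1 - 1, p.2) ↔ 2 ≤ p.1 := by unfold inR; simp; omega
  have h2 : inR r s (p.1, p.2 - 1) ↔ 2 ≤ p.2 := by unfold inR; simp; omega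
  have hne : (p.1 - 1, p.2) ≠ (p.1, p.2 - 1) := fun h => by
    have := congrArg Prod.snd h
    simp only at this
    omega
  unfold dsum downSet
  rw [Finset.sum_filter, Finset.sum_pair hne]
  simp only [Finset.filter_nonempty_iff, Finset.mem_insert, Finset.mem_singleton, exists_eq_or_imp, exists_eq_left, h1, h2]
  split_ifs <;> first | rfl | omega

theorem usum_eq (y : ℤ × ℤ → ℝ) {p : ℤ × ℤ} (hp : inR r s p) : usum r s y p =
    if p.1 = r ∧ p.2 = s then 1 else
      ((if p.1 < r then (y (p.1 + 1, p.2))⁻¹ else 0) +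
        if p.2 < s then (y (p.1, p.2 + 1))⁻¹ else 0)⁻¹ := by
  unfold inR at hp
  have h1 : inR r s (p.1 + 1, p.2) ↔ p.1 < r := by unfold inR; simp; omega
  have h2 : inR r s (p.1, p.2 + 1) ↔ p.2 < s := by unfold inR; simp; omega
  have hne : (p.1 + 1, p.2) ≠ (p.1, p.2 + 1) := fun h => by
    have := congrArg Prod.snd h
    simp only at this
    omega
  unfold usum upSet
  rw [Finset.sum_filter, Finset.sum_pair hne]
  simp only [Finset.filter_nonempty_iff, Finset.mem_insert, Finset.mem_singleton, exists_eq_or_imp, exists_eq_left, h1, h2]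
  split_ifs <;> first | rfl | omega

theorem rectList_eq (a b : ℕ) : rectList a b = (List.range a).reverse.flatMap fun i : ℕ =>
    (List.range b).reverse.map fun j : ℕ => ((i : ℤ) + 1, (j : ℤ) + 1) := by
  simp [rectList, List.flatMap_assoc, List.map_flatMap]
  simp only [← List.map_reverse]
  simp only [List.map_eq_flatMap]

theorem mem_rectList {p : ℤ × ℤ} : p ∈ rectList r s ↔ inR r s p := by
  obtain ⟨a, b⟩ := p
  simp only [rectList_eq, List.mem_flatMap, List.mem_reverse, List.mem_range, List.mem_map,
    Prod.mk.injEq, inR]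
  constructor
  · rintro ⟨i, hi, j, hj, rfl, rfl⟩
    omega
  · rintro ⟨h1, h2, h3, h4⟩
    exact ⟨(a - 1).toNat, by omega, (b - 1).toNat, by omega, by omega, by omega⟩

theorem pairwise_rectList_reverse : (rectList r s).reverse.Pairwise
    fun p q => p.1 < q.1 ∨ p.1 = q.1 ∧ p.2 < q.2 := by
  rw [List.pairwise_reverse, rectList_eq, List.pairwise_flatMap]
  constructor
  · intro i _
    rw [List.pairwise_map, List.pairwise_reverse]
    exact List.pairwise_lt_range.imp fun h => Or.inr ⟨rfl, by simpa using h⟩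
  · rw [List.pairwise_reverse]
    refine List.pairwise_lt_range.imp fun h p hp q hq => ?_
    rw [List.mem_map] at hp hq
    obtain ⟨_, _, rfl⟩ := hp
    obtain ⟨_, _, rfl⟩ := hq
    exact Or.inl (by simpa using h)

theorem foldl_toggle_of_notMem {q : ℤ × ℤ} : ∀ {L : List (ℤ × ℤ)} {y : ℤ × ℤ → ℝ}, q ∉ L →
    L.foldl (fun y p => toggle r s p y) y q = y q
  | [], _, _ => rfl
  | p :: L, y, h => by
    rw [List.mem_cons, not_or] at h
    rw [List.foldl_cons, foldl_toggle_of_notMem h.2, toggle, if_neg h.1]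

/-- Inverse rowmotion toggles each label after its lower covers and before its upper covers. -/
theorem rhoInv_apply (y : ℤ × ℤ → ℝ) {p : ℤ × ℤ} (hp : inR r s p) :
    rhoInv r s y p = usum r s y p * dsum r s (rhoInv r s y) p / y p := by
  have hpw := pairwise_rectList_reverse (r := r) (s := s)
  obtain ⟨A, B, hAB⟩ := List.append_of_mem (List.mem_reverse.2 (mem_rectList.2 hp))
  rw [hAB, List.pairwise_append, List.pairwise_cons] at hpw
  obtain ⟨-, ⟨hB, -⟩, hA⟩ := hpw
  have hA' : ∀ q, (p.1 < q.1 ∨ p.1 = q.1 ∧ p.2 ≤ q.2) → q ∉ A := by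
    intro q hq hqA
    have := hA q hqA p (by simp)
    omega
  have hB' : ∀ q, (q.1 < p.1 ∨ q.1 = p.1 ∧ q.2 ≤ p.2) → q ∉ B := by
    intro q hq hqB
    have := hB q hqB
    omega
  set z := A.foldl (fun y p => toggle r s p y) y with hz
  have hf : rhoInv r s y = B.foldl (fun y p => toggle r s p y) (toggle r s p z) := by
    rw [rhoInv, hAB, List.foldl_append, List.foldl_cons]
  have hzp : ∀ q, (p.1 < q.1 ∨ p.1 = q.1 ∧ p.2 ≤ q.2) → z q = y q :=
    fun q hq => foldl_toggle_of_notMem (hA' q hq)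
  have hfz : ∀ q, (q.1 < p.1 ∨ q.1 = p.1 ∧ q.2 < p.2) → rhoInv r s y q = z q := by
    intro q hq
    rw [hf, foldl_toggle_of_notMem (hB' q (by omega)), toggle, if_neg]
    rintro rfl
    omega
  have h1 : rhoInv r s y p = usum r s z p * dsum r s z p / z p := by
    rw [hf, foldl_toggle_of_notMem (hB' p (by omega)), toggle, if_pos rfl]
  rw [h1, hzp p (by omega), usum_eq z hp, usum_eq y hp, dsum_eq z hp, dsum_eq _ hp,
    hzp _ (by simp), hzp _ (by simp), hfz _ (by simp), hfz _ (by simp)]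

end Rowmotion

section Transfer

theorem CoverStep_iff {p q : ℤ × ℤ} :
    CoverStep p q ↔ p = (q.1 - 1, q.2) ∨ p = (q.1, q.2 - 1) := by
  simp only [CoverStep, Prod.ext_iff]
  omega

/-- A directed path is trivial or consists of a directed path followed by an edge. -/
theorem mem_dirPaths_iff_concat {V : Type*} {E : V → V → Prop} {a b : V} {l : List V} :
    l ∈ dirPaths E a b ↔ (l = [a] ∧ a = b) ∨ ∃ c, E c b ∧ ∃ l' ∈ dirPaths E a c, l = l' ++ [b] := by
  constructor
  · rintro ⟨h1, h2, h3⟩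
    rcases List.eq_nil_or_concat l with rfl | ⟨m, d, rfl⟩
    · simp at h2
    · simp only [List.concat_eq_append, List.getLast?_append, List.getLast?_singleton,
        Option.some_or, Option.some.injEq] at h3
      subst h3
      rw [List.concat_eq_append] at h1 h2 ⊢
      rcases List.eq_nil_or_concat m with rfl | ⟨m', c, rfl⟩
      · simp only [List.nil_append, List.head?_cons, Option.some.injEq] at h2
        subst h2
        exact Or.inl ⟨rfl, rfl⟩
      · rw [List.concat_eq_append] at h1 h2 ⊢
        rw [List.isChain_append] at h1
        refine Or.inr ⟨c, h1.2.2 c (by simp) d (by simp), m' ++ [c], ⟨h1.1, ?_, by simp⟩, rfl⟩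
        rwa [List.head?_append_of_ne_nil _ (by simp)] at h2
  · rintro (⟨rfl, rfl⟩ | ⟨c, hc, l', ⟨h1, h2, h3⟩, rfl⟩)
    · exact ⟨List.isChain_singleton _, rfl, rfl⟩
    · refine ⟨List.isChain_append.2 ⟨h1, List.isChain_singleton _, ?_⟩, ?_, by simp⟩
      · intro u hu w hw
        rw [h3] at hu
        simp at hu hw
        rwa [← hu, ← hw]
      · rw [List.head?_append, h2]
        rfl

theorem le_of_mem_dirPaths_CoverStep {b : ℤ × ℤ} {l : List (ℤ × ℤ)} :
    ∀ {a : ℤ × ℤ}, l ∈ dirPaths CoverStep a b → a.1 ≤ b.1 ∧ a.2 ≤ b.2 := by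
  induction l with
  | nil => intro a h; simp [dirPaths] at h
  | cons y l ih =>
    intro a h
    rcases mem_dirPaths_iff.1 h with ⟨-, rfl⟩ | ⟨d, hd, l', hl', h1⟩
    · exact ⟨le_rfl, le_rfl⟩
    · obtain ⟨rfl, rfl⟩ := List.cons_eq_cons.1 h1
      have h1 := ih hl'
      unfold CoverStep at hd
      omega

theorem finite_dirPaths_CoverStep (a b : ℤ × ℤ) : (dirPaths CoverStep a b).Finite := by
  induction h : (b.1 + b.2 - a.1 - a.2).toNat using Nat.strong_induction_on generalizing b with
  | _ n ih =>
    by_cases hab : a.1 ≤ b.1 ∧ a.2 ≤ b.2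
    · by_cases hne : a = b
      · refine (Set.finite_singleton [a]).subset fun l hl => ?_
        rcases mem_dirPaths_iff_concat.1 hl with h1 | ⟨c, hc, l', hl', -⟩
        · exact h1.1
        · have h2 := le_of_mem_dirPaths_CoverStep (a := a) hl'
          subst hne
          unfold CoverStep at hc
          omega
      · have : ¬ (a.1 = b.1 ∧ a.2 = b.2) := fun h => hne (Prod.ext h.1 h.2)
        refine (((ih _ (by omega) (b.1 - 1, b.2) rfl).image (· ++ [b])).union
          ((ih _ (by omega) (b.1, b.2 - 1) rfl).image (· ++ [b]))).subset fun l hl => ?_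
        rcases mem_dirPaths_iff_concat.1 hl with h1 | ⟨c, hc, l', hl', rfl⟩
        · exact absurd h1.2 hne
        · rcases CoverStep_iff.1 hc with rfl | rfl
          · exact Or.inl ⟨l', hl', rfl⟩
          · exact Or.inr ⟨l', hl', rfl⟩
    · refine Set.finite_empty.subset fun l hl => ?_
      exact hab (le_of_mem_dirPaths_CoverStep (a := a) hl)

theorem phiInv_eq_finsum (x : ℤ × ℤ → ℝ) (p : ℤ × ℤ) :
    phiInv x p = ∑ᶠ l ∈ dirPaths CoverStep (1, 1) p, (l.map x).prod :=
  finsum_set_coe_eq_finsum_mem (f := fun l : List (ℤ × ℤ) => (l.map x).prod)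
    (dirPaths CoverStep (1, 1) p)

theorem phiInv_of_lt (x : ℤ × ℤ → ℝ) {p : ℤ × ℤ} (hp : p.1 < 1 ∨ p.2 < 1) : phiInv x p = 0 := by
  have : dirPaths CoverStep (1, 1) p = ∅ := by
    rw [Set.eq_empty_iff_forall_notMem]
    intro l hl
    have := le_of_mem_dirPaths_CoverStep (a := (1, 1)) hl
    simp at this
    omega
  rw [phiInv_eq_finsum, this, finsum_mem_empty]

theorem phiInv_one_one (x : ℤ × ℤ → ℝ) : phiInv x (1, 1) = x (1, 1) := by
  have : dirPaths CoverStep (1, 1) (1, 1) = {[(1, 1)]} := by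
    ext l
    rw [mem_dirPaths_iff_concat, Set.mem_singleton_iff]
    constructor
    · rintro (h | ⟨c, hc, l', hl', -⟩)
      · exact h.1
      · have := le_of_mem_dirPaths_CoverStep (a := (1, 1)) hl'
        unfold CoverStep at hc
        simp at this hc
        omega
    · exact fun h => Or.inl ⟨h, rfl⟩
  rw [phiInv_eq_finsum, this, finsum_mem_singleton]
  simp

theorem phiInv_of_ne (x : ℤ × ℤ → ℝ) {p : ℤ × ℤ} (hp : p ≠ (1, 1)) :
    phiInv x p = x p * (phiInv x (p.1 - 1, p.2) + phiInv x (p.1, p.2 - 1)) := by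
  have hset : dirPaths CoverStep (1, 1) p =
      (· ++ [p]) '' dirPaths CoverStep (1, 1) (p.1 - 1, p.2) ∪
      (· ++ [p]) '' dirPaths CoverStep (1, 1) (p.1, p.2 - 1) := by
    ext l
    rw [mem_dirPaths_iff_concat]
    constructor
    · rintro (h | ⟨c, hc, l', hl', rfl⟩)
      · exact absurd h.2.symm hp
      · rcases CoverStep_iff.1 hc with rfl | rfl
        · exact Or.inl ⟨l', hl', rfl⟩
        · exact Or.inr ⟨l', hl', rfl⟩
    · rintro (⟨l', hl', rfl⟩ | ⟨l', hl', rfl⟩)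
      · exact Or.inr ⟨_, CoverStep_iff.2 (Or.inl rfl), l', hl', rfl⟩
      · exact Or.inr ⟨_, CoverStep_iff.2 (Or.inr rfl), l', hl', rfl⟩
  have hdisj : Disjoint ((· ++ [p]) '' dirPaths CoverStep (1, 1) (p.1 - 1, p.2))
      ((· ++ [p]) '' dirPaths CoverStep (1, 1) (p.1, p.2 - 1)) := by
    rw [Set.disjoint_left]
    rintro _ ⟨l, hl, rfl⟩ ⟨l', hl', h⟩
    have h := List.append_cancel_right h
    subst h
    have h1 := hl.2.2.symm.trans hl'.2.2
    simp at h1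
  have himage : ∀ q, ∑ᶠ l ∈ (· ++ [p]) '' dirPaths CoverStep (1, 1) q, (l.map x).prod =
      x p * phiInv x q := by
    intro q
    rw [finsum_mem_image fun l _ l' _ h => List.append_cancel_right h, phiInv_eq_finsum,
      mul_finsum_mem]
    refine finsum_mem_congr rfl fun l _ => ?_
    simp [mul_comm]
  rw [phiInv_eq_finsum x p, hset, finsum_mem_union hdisj
    ((finite_dirPaths_CoverStep _ _).image _) ((finite_dirPaths_CoverStep _ _).image _),
    himage, himage, mul_add]

end Transfer

section Iterates

variable {r s : ℕ} {x : ℤ × ℤ → ℝ}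

theorem minor_lower_sum {a b : ℤ} {n : ℕ} (h1 : minor r s x a b (n + 1) ≠ 0)
    (h2 : minor r s x a (b + 1) n ≠ 0) :
    minor r s x (a + 1) b n / minor r s x a b (n + 1) +
      (if n = 0 then 0 else minor r s x (a + 1) (b + 1) (n - 1) / minor r s x a (b + 1) n) =
    minor r s x a b n * minor r s x (a + 1) (b + 1) n /
      (minor r s x a b (n + 1) * minor r s x a (b + 1) n) := by
  cases n with
  | zero => simp
  | succ n =>
    have h := minor_dodgson (r := r) (s := s) (x := x) a b n
    rw [if_neg (by omega), Nat.add_sub_cancel]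
    field_simp
    linear_combination h

theorem minor_upper_sum {a b : ℤ} {n : ℕ} (h1 : minor r s x (a + 1) (b + 1) n ≠ 0)
    (h2 : minor r s x (a + 1) b (n + 1) ≠ 0) :
    minor r s x a (b + 1) (n + 1) / minor r s x (a + 1) (b + 1) n +
      minor r s x a b (n + 2) / minor r s x (a + 1) b (n + 1) =
    minor r s x a b (n + 1) * minor r s x (a + 1) (b + 1) (n + 1) /
      (minor r s x (a + 1) (b + 1) n * minor r s x (a + 1) b (n + 1)) := by
  have h := minor_dodgson (r := r) (s := s) (x := x) a b n
  field_simp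
  linear_combination h

theorem label_eq_minor (hx : ∀ p, inR r s p → 0 < x p) {i n : ℕ} (hi : i < r) (hn : n < s) :
    x ((i : ℤ) + 1, (n : ℤ) + 1) =
      minor r s x 1 (i + 1) (n + 1) * minor r s x 1 (i + 2) n /
        (minor r s x 1 (i + 1) n * minor r s x 1 (i + 2) (n + 1)) := by
  have h1 := minor_one (x := x) (show i ≤ r by omega) (show n ≤ s by omega)
  have h2 := minor_one (x := x) (show i ≤ r by omega) (show n + 1 ≤ s by omega)
  have h3 := minor_one (x := x) (show i + 1 ≤ r by omega) (show n ≤ s by omega)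
  have h4 := minor_one (x := x) (show i + 1 ≤ r by omega) (show n + 1 ≤ s by omega)
  have e : ((i + 1 : ℕ) : ℤ) + 1 = i + 2 := by push_cast; ring
  rw [e, Finset.prod_range_succ, ← h1] at h3
  rw [e, Finset.prod_range_succ, ← h2] at h4
  have hp1 := minor_pos (a := 1) (b := i + 1) (n := n) (by omega) hx le_rfl (by omega) (by omega)
    (by omega) (by omega)
  have hp2 := minor_pos (a := 1) (b := i + 1) (n := n + 1) (by omega) hx le_rfl (by omega)
    (by omega) (by omega) (by omega)
  have hx' : ∀ t < n + 1, 0 < x ((i : ℤ) + 1, (t : ℤ) + 1) := by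
    intro t ht
    refine hx _ ⟨?_, ?_, ?_, ?_⟩ <;> simp <;> omega
  have hprod : 0 < ∏ t ∈ Finset.range n, (x ((i : ℤ) + 1, (t : ℤ) + 1))⁻¹ :=
    Finset.prod_pos fun t ht => inv_pos.2 (hx' t (by simp at ht; omega))
  have := hx' n (by omega)
  rw [h3, h4, Finset.prod_range_succ]
  generalize ∏ t ∈ Finset.range n, (x ((i : ℤ) + 1, (t : ℤ) + 1))⁻¹ = c at hprod ⊢
  field_simp

/-- The formula for the `k`-th inverse iterate of rowmotion, for all entries of a labeling. -/
def IsMinorRatio (r s : ℕ) (x : ℤ × ℤ → ℝ) (k : ℕ) (y : ℤ × ℤ → ℝ) : Prop :=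
  ∀ i n : ℕ, i < r → n < s → k + i + n + 2 ≤ r + s →
    y ((i : ℤ) + 1, (n : ℤ) + 1) =
      minor r s x (k + 2) (i + k + 2) n / minor r s x (k + 1) (i + k + 2) (n + 1)

theorem isMinorRatio_phiInv (hx : ∀ p, inR r s p → 0 < x p) :
    IsMinorRatio r s x 0 (phiInv x) := by
  have key : ∀ N i n : ℕ, i + n = N → i < r → n < s → phiInv x ((i : ℤ) + 1, (n : ℤ) + 1) =
      minor r s x 2 (i + 2) n / minor r s x 1 (i + 2) (n + 1) := by
    intro N
    induction N using Nat.strong_induction_on with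
    | _ N ih =>
      intro i n hN hi hn
      have hpos : ∀ {b : ℤ} {m : ℕ}, 1 ≤ b → b ≤ i + 2 → m ≤ n + 1 → 0 < minor r s x 1 b m :=
        fun h1 h2 h3 => minor_pos (by omega) hx le_rfl h1 (by omega) (by omega) (by omega)
      have p1 := hpos (b := i + 1) (m := n) (by omega) (by omega) (by omega)
      have p2 := hpos (b := i + 1) (m := n + 1) (by omega) (by omega) (by omega)
      have p3 := hpos (b := i + 2) (m := n) (by omega) (by omega) (by omega)
      have p4 := hpos (b := i + 2) (m := n + 1) (by omega) (by omega) (by omega)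
      have hlab := label_eq_minor hx hi hn
      by_cases h0 : i = 0 ∧ n = 0
      · obtain ⟨rfl, rfl⟩ := h0
        simp only [Nat.cast_zero, zero_add] at hlab ⊢
        rw [phiInv_one_one, hlab, minor_self (by omega) (by push_cast; omega) (by omega)]
        simp
      · have hlow := minor_lower_sum (a := 1) p2.ne' (n := n) (by
          rw [show (i : ℤ) + 1 + 1 = i + 2 by ring]; exact p3.ne')
        rw [show (i : ℤ) + 1 + 1 = i + 2 by ring, show (1 : ℤ) + 1 = 2 by rfl] at hlow
        have hA : phiInv x ((i : ℤ) + 1 - 1, (n : ℤ) + 1) =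
            minor r s x 2 (i + 1) n / minor r s x 1 (i + 1) (n + 1) := by
          cases i with
          | zero =>
            rw [phiInv_of_lt x (by simp), minor_eq_zero_of_lt (by omega) (by omega), zero_div]
          | succ i =>
            have := ih (i + n) (by omega) i n rfl (by omega) hn
            push_cast
            rw [add_sub_cancel_right, this, show (i : ℤ) + 1 + 1 = i + 2 by ring]
        have hB : phiInv x ((i : ℤ) + 1, (n : ℤ) + 1 - 1) = if n = 0 then 0 else
            minor r s x 2 (i + 2) (n - 1) / minor r s x 1 (i + 2) n := by
          cases n with
          | zero => rw [phiInv_of_lt x (by simp), if_pos rfl]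
          | succ n =>
            have := ih (i + n) (by omega) i n rfl hi (by omega)
            push_cast
            rw [add_sub_cancel_right, this]
        rw [phiInv_of_ne x (by simp only [ne_eq, Prod.mk.injEq]; omega)]
        simp only
        rw [hA, hB, hlow, hlab]
        field_simp
  intro i n hi hn _
  simpa using key _ i n rfl hi hn

theorem isMinorRatio_rhoInv (hx : ∀ p, inR r s p → 0 < x p) {k : ℕ} {y : ℤ × ℤ → ℝ}
    (hy : IsMinorRatio r s x k y) : IsMinorRatio r s x (k + 1) (rhoInv r s y) := by
  suffices key : ∀ N i n : ℕ, i + n = N → i < r → n < s → k + 1 + i + n + 2 ≤ r + s →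
      rhoInv r s y ((i : ℤ) + 1, (n : ℤ) + 1) =
        minor r s x (k + 3) (i + k + 3) n / minor r s x (k + 2) (i + k + 3) (n + 1) by
    intro i n hi hn h
    rw [key _ i n rfl hi hn h]
    congr 2
  intro N
  induction N using Nat.strong_induction_on with
  | _ N ih =>
    intro i n hN hi hn hk
    have hR : inR r s ((i : ℤ) + 1, (n : ℤ) + 1) := by
      refine ⟨?_, ?_, ?_, ?_⟩ <;> simp <;> omega
    have hpos : ∀ {a b : ℤ} {m : ℕ}, 1 ≤ a → a ≤ b → b ≤ a + r → m ≤ n + 1 → b ≤ i + k + 3 →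
        0 < minor r s x a b m :=
      fun h1 h2 h3 h4 h5 => minor_pos (by omega) hx h1 h2 h3 (by omega) (by omega)
    have p1 := hpos (a := k + 2) (b := i + k + 3) (m := n) (by omega) (by omega) (by omega)
      (by omega) (by omega)
    have p2 := hpos (a := k + 2) (b := i + k + 2) (m := n + 1) (by omega) (by omega) (by omega)
      (by omega) (by omega)
    have p3 := hpos (a := k + 1) (b := i + k + 2) (m := n + 1) (by omega) (by omega) (by omega)
      (by omega) (by omega)
    have p4 := hpos (a := k + 2) (b := i + k + 3) (m := n + 1) (by omega) (by omega) (by omega)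
      (by omega) (by omega)
    have p5 := hpos (a := k + 2) (b := i + k + 2) (m := n) (by omega) (by omega) (by omega)
      (by omega) (by omega)
    have eb : (i : ℤ) + k + 2 + 1 = i + k + 3 := by ring
    have e1 : (k : ℤ) + 1 + 1 = k + 2 := by ring
    have e2 : (k : ℤ) + 2 + 1 = k + 3 := by ring
    have hup := minor_upper_sum (r := r) (s := s) (x := x) (a := k + 1) (b := i + k + 2) (n := n)
    have hlow := minor_lower_sum (r := r) (s := s) (x := x) (a := k + 2) (b := i + k + 2) (n := n)
    simp only [eb, e1, e2] at hup hlow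
    have hU : usum r s y ((i : ℤ) + 1, (n : ℤ) + 1) =
        (minor r s x (k + 1) (i + k + 3) (n + 1) / minor r s x (k + 2) (i + k + 3) n +
          minor r s x (k + 1) (i + k + 2) (n + 2) / minor r s x (k + 2) (i + k + 2) (n + 1))⁻¹ := by
      rw [usum_eq y hR]
      simp only
      rw [if_neg (by omega)]
      congr 2
      · split_ifs with h
        · have := hy (i + 1) n (by omega) hn (by omega)
          push_cast at this
          rw [this, inv_div, show (i : ℤ) + 1 + k + 2 = i + k + 3 by ring]
        · rw [minor_eq_zero_of_add_lt (by omega) (by omega), zero_div]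
      · split_ifs with h
        · have := hy i (n + 1) hi (by omega) (by omega)
          push_cast at this
          rw [this, inv_div]
        · rw [show n + 2 = s + 1 by omega, minor_width (by omega) (by omega) (by omega), zero_div]
    have hL : dsum r s (rhoInv r s y) ((i : ℤ) + 1, (n : ℤ) + 1) =
        minor r s x (k + 3) (i + k + 2) n / minor r s x (k + 2) (i + k + 2) (n + 1) +
          if n = 0 then 0 else
            minor r s x (k + 3) (i + k + 3) (n - 1) / minor r s x (k + 2) (i + k + 3) n := by
      rw [dsum_eq _ hR]
      simp only
      by_cases h0 : i = 0 ∧ n = 0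
      · obtain ⟨rfl, rfl⟩ := h0
        rw [if_pos (by simp), if_pos rfl, show ((0 : ℕ) : ℤ) + k + 2 = k + 2 by simp,
          minor_self (by omega) (by push_cast; omega) (by omega)]
        simp
      · rw [if_neg (by omega)]
        congr 1
        · cases i with
          | zero =>
            rw [if_neg (by simp), minor_eq_zero_of_lt (by omega) (by omega), zero_div]
          | succ i =>
            have := ih (i + n) (by omega) i n rfl (by omega) hn (by omega)
            push_cast
            rw [if_pos (by omega), add_sub_cancel_right, this,
              show (i : ℤ) + 1 + k + 2 = i + k + 3 by ring]
        · cases n with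
          | zero => rw [if_neg (by simp), if_pos rfl]
          | succ n =>
            have := ih (i + n) (by omega) i n rfl hi (by omega) (by omega)
            push_cast
            rw [if_pos (by omega), add_sub_cancel_right, this]
    rw [rhoInv_apply y hR, hU, hL, hup p1.ne' p2.ne', hlow p2.ne' p1.ne',
      hy i n hi hn (by omega)]
    field_simp

theorem isMinorRatio_iterate (hx : ∀ p, inR r s p → 0 < x p) (k : ℕ) :
    IsMinorRatio r s x k ((rhoInv r s)^[k] (phiInv x)) := by
  induction k with
  | zero => exact isMinorRatio_phiInv hx
  | succ k ih =>
    rw [Function.iterate_succ_apply']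
    exact isMinorRatio_rhoInv hx ih

end Iterates

/-- **Theorem 3.6(a).** Let `y = φ⁻¹(x)` and `(i,j) ∈ R = [r] × [s]`. For every integer
`k` with `0 ≤ k ≤ r + s - i - j`,
`ρ^{-k}(y)_{ij} = W_{k+2, i+k+1}^{(j-1)}(x) / W_{k+1, i+k+1}^{(j)}(x)`. -/
theorem iterated_rowmotion_formula (r s : ℕ) (hr : 1 ≤ r) (hs : 1 ≤ s)
    (x : ℤ × ℤ → ℝ) (hx : ∀ p, inR r s p → 0 < x p)
    (i j : ℤ) (hij : inR r s (i, j)) (k : ℤ) (hk0 : 0 ≤ k)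
    (hk : k ≤ (r : ℤ) + s - i - j) :
    rhoPow r s (-k) (phiInv x) (i, j)
      = W r s x (k + 2) (i + k + 1) (j - 1) / W r s x (k + 1) (i + k + 1) j := by
  obtain ⟨hi1, hi2, hj1, hj2⟩ := hij
  simp only at hi1 hi2 hj1 hj2
  lift k to ℕ using hk0
  obtain ⟨m, rfl⟩ : ∃ m : ℕ, i = m + 1 := ⟨(i - 1).toNat, by omega⟩
  obtain ⟨n, rfl⟩ : ∃ n : ℕ, j = n + 1 := ⟨(j - 1).toNat, by omega⟩
  have hpow : rhoPow r s (-(k : ℤ)) (phiInv x) = (rhoInv r s)^[k] (phiInv x) := by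
    unfold rhoPow
    split_ifs with h
    · obtain rfl : k = 0 := by omega
      simp
    · simp
  have h1 := W_natCast (r := r) (s := s) (x := x) (k + 2) (m + 1 + k + 1) n
  have h2 := W_natCast (r := r) (s := s) (x := x) (k + 1) (m + 1 + k + 1) (n + 1)
  push_cast at h2
  rw [hpow, isMinorRatio_iterate hx k m n (by omega) (by omega) (by omega), add_sub_cancel_right,
    h1, h2, show (m : ℤ) + 1 + k + 1 = m + k + 2 by ring]

end Paper
end
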